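/- Let Δ be a countably infinite structure with finite relational signature that is ordered, homogeneous, Ramsey, and finitely bounded, and let Γ be a reduct of Δ with finite relational signature. Then the problem Expr_pp(Γ) is decidable. -/

import Mathlib

open FirstOrder FirstOrder.Language

namespace PaperDef

/-- The structure `M` is *ordered*: some binary relation symbol of the signature
denotes a linear order on the domain. -/
def Ordered (L : Language) (M : Type*) [L.Structure M] : Prop :=
  ∃ r : L.Relations 2, IsLinearOrder M (fun a b => Structure.RelMap r ![a, b])

/-- A class of structures is a *Ramsey class*. -/
def RamseyClass {L : Language} (K : Set (CategoryTheory.Bundled.{0} L.Structure)) : Prop :=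
  ∀ k : ℕ, 1 ≤ k → ∀ H ∈ K, ∀ P ∈ K, ∃ S ∈ K,
    ∀ χ : {Q : L.Substructure S // Nonempty (P ≃[L] Q)} → Fin k,
      ∃ e : H ↪[L] S,
        ∀ Q₁ Q₂ : {Q : L.Substructure S // Nonempty (P ≃[L] Q)},
          (Q₁.1 : Set S) ⊆ Set.range e → (Q₂.1 : Set S) ⊆ Set.range e → χ Q₁ = χ Q₂

/-- `M` is *finitely bounded*: membership of a finite(ly generated) structure in the age of `M`
is characterized by finitely many forbidden substructures. -/
def FinitelyBounded (L : Language) (M : Type) [L.Structure M] : Prop :=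
  ∃ (k : ℕ) (F : Fin k → CategoryTheory.Bundled.{0} L.Structure),
    (∀ i, Structure.FG L (F i)) ∧
    ∀ A : CategoryTheory.Bundled.{0} L.Structure, Structure.FG L A →
      (A ∈ L.age M ↔ ∀ i, ¬ Nonempty ((F i) ↪[L] A))

/-- The `L'`-structure on `M` is a *reduct* of the `L`-structure on `M`:
every relation of the former is first-order definable in the latter. -/
def IsReduct (L L' : Language) (M : Type*) [L.Structure M] [L'.Structure M] : Prop :=
  ∀ (n : ℕ) (r : L'.Relations n), ∃ φ : L.Formula (Fin n),
    ∀ x : Fin n → M, Structure.RelMap r x ↔ φ.Realize x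

/-- Two `n`-tuples have the same (complete first-order) type. -/
def SameType (L : Language) (M : Type*) [L.Structure M] {n : ℕ} (a b : Fin n → M) : Prop :=
  ∀ φ : L.Formula (Fin n), φ.Realize a ↔ φ.Realize b

/-- A function is *canonical*: it maps tuples of equal types to tuples of equal types. -/
def Canonical (L L' : Language) (X Ω : Type*) [L.Structure X] [L'.Structure Ω]
    (f : X → Ω) : Prop :=
  ∀ (n : ℕ) (a b : Fin n → X), SameType L X a b →
    SameType L' Ω (fun i => f (a i)) (fun i => f (b i))

/-- A function is *canonical on a set `F`*. -/
def CanonicalOn (L L' : Language) (X Ω : Type*) [L.Structure X] [L'.Structure Ω]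
    (F : Set X) (f : X → Ω) : Prop :=
  ∀ (n : ℕ) (a b : Fin n → X), (∀ i, a i ∈ F) → (∀ i, b i ∈ F) → SameType L X a b →
    SameType L' Ω (fun i => f (a i)) (fun i => f (b i))

/-- `M` is ω-categorical: every countable model of its complete theory is isomorphic to it. -/
def OmegaCategorical (L : Language) (M : Type) [L.Structure M] : Prop :=
  ∀ (N : Type) [L.Structure N], Countable N →
    (∀ φ : L.Sentence, φ ∈ L.completeTheory M → N ⊨ φ) → Nonempty (M ≃[L] N)

/-- Primitive positive formulas: built from atomic formulas using `∧` and `∃`. -/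
inductive IsPrimitivePositive {L : Language} {α : Type*} :
    ∀ {n : ℕ}, L.BoundedFormula α n → Prop
  | atomic {n : ℕ} {φ : L.BoundedFormula α n} (h : φ.IsAtomic) : IsPrimitivePositive φ
  | inf {n : ℕ} {φ ψ : L.BoundedFormula α n} :
      IsPrimitivePositive φ → IsPrimitivePositive ψ → IsPrimitivePositive (φ ⊓ ψ)
  | ex {n : ℕ} {φ : L.BoundedFormula α (n + 1)} :
      IsPrimitivePositive φ → IsPrimitivePositive φ.ex

/-- Existential formulas: existentially quantified quantifier-free formulas. -/
inductive IsExistential {L : Language} {α : Type*} :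
    ∀ {n : ℕ}, L.BoundedFormula α n → Prop
  | of_isQF {n : ℕ} {φ : L.BoundedFormula α n} (h : φ.IsQF) : IsExistential φ
  | ex {n : ℕ} {φ : L.BoundedFormula α (n + 1)} : IsExistential φ → IsExistential φ.ex

/-- Existential positive formulas: built from atomic formulas using `∧`, `∨` and `∃`. -/
inductive IsExistentialPositive {L : Language} {α : Type*} :
    ∀ {n : ℕ}, L.BoundedFormula α n → Prop
  | atomic {n : ℕ} {φ : L.BoundedFormula α n} (h : φ.IsAtomic) : IsExistentialPositive φ
  | inf {n : ℕ} {φ ψ : L.BoundedFormula α n} :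
      IsExistentialPositive φ → IsExistentialPositive ψ → IsExistentialPositive (φ ⊓ ψ)
  | sup {n : ℕ} {φ ψ : L.BoundedFormula α n} :
      IsExistentialPositive φ → IsExistentialPositive ψ → IsExistentialPositive (φ ⊔ ψ)
  | ex {n : ℕ} {φ : L.BoundedFormula α (n + 1)} :
      IsExistentialPositive φ → IsExistentialPositive φ.ex

/-- A `k`-ary operation *preserves* an `m`-ary relation. -/
def Preserves {D : Type*} {k m : ℕ} (f : (Fin k → D) → D) (R : (Fin m → D) → Prop) : Prop :=
  ∀ rows : Fin k → Fin m → D, (∀ j, R (rows j)) → R (fun i => f (fun j => rows j i))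

/-- A unary operation *preserves* an `m`-ary relation. -/
def Preserves1 {D : Type*} {m : ℕ} (f : D → D) (R : (Fin m → D) → Prop) : Prop :=
  ∀ a : Fin m → D, R a → R (fun i => f (a i))

/-- An endomorphism of the structure `M`. -/
def IsEndo (L : Language) (M : Type*) [L.Structure M] (f : M → M) : Prop :=
  ∀ (n : ℕ) (r : L.Relations n) (x : Fin n → M),
    Structure.RelMap r x → Structure.RelMap r (fun i => f (x i))

/-- A self-embedding of the structure `M`. -/
def IsSelfEmb (L : Language) (M : Type*) [L.Structure M] (f : M → M) : Prop :=
  Function.Injective f ∧ ∀ (n : ℕ) (r : L.Relations n) (x : Fin n → M),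
    (Structure.RelMap r (fun i => f (x i)) ↔ Structure.RelMap r x)

/-- A polymorphism of the structure `M`. -/
def IsPoly (L : Language) (M : Type*) [L.Structure M] {k : ℕ} (f : (Fin k → M) → M) : Prop :=
  ∀ (n : ℕ) (r : L.Relations n), Preserves f (fun x : Fin n → M => Structure.RelMap r x)

/-- The set of endomorphisms of `M`. -/
def EndSet (L : Language) (M : Type*) [L.Structure M] : Set (M → M) :=
  {f | IsEndo L M f}

/-- Two tuples lie in the same orbit of the automorphism group. -/
def SameOrbit (L : Language) (M : Type*) [L.Structure M] {n : ℕ} (a b : Fin n → M) : Prop :=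
  ∃ α : M ≃[L] M, ∀ i, α (a i) = b i

/-- The subsets `s` and `t` induce isomorphic substructures. -/
def SetIso (L : Language) (X : Type*) [L.Structure X] (s t : Set X) : Prop :=
  ∃ g : s ≃ t, ∀ (n : ℕ) (r : L.Relations n) (x : Fin n → s),
    (Structure.RelMap r (fun j => ((x j : X))) ↔ Structure.RelMap r (fun j => ((g (x j) : t) : X)))

/-- The `L[[Fin n]]`-structure on `M` obtained by naming the constants `c 0, …, c (n-1)`. -/
def withConstantsStruct (L : Language) {M : Type*} [L.Structure M] {n : ℕ} (c : Fin n → M) :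
    (L[[Fin n]]).Structure M :=
  letI := constantsOn.structure c
  inferInstance

/-- Two sequences of `n` tuples from a product `Ξ₁ × ⋯ × Ξₘ` have the same type:
componentwise, the corresponding `n`-tuples have the same type. -/
def SameSeqType {m : ℕ} (Ls : Fin m → Language) (Xs : Fin m → Type*)
    [∀ i, (Ls i).Structure (Xs i)] {n : ℕ} (a b : Fin n → ∀ i, Xs i) : Prop :=
  ∀ i, SameType (Ls i) (Xs i) (fun j => a j i) (fun j => b j i)

/-- A function defined on a product of structures is canonical. -/
def CanonicalProd {m : ℕ} (Ls : Fin m → Language) (Xs : Fin m → Type*)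
    [∀ i, (Ls i).Structure (Xs i)] (L' : Language) (Ω : Type*) [L'.Structure Ω]
    (f : (∀ i, Xs i) → Ω) : Prop :=
  ∀ (n : ℕ) (a b : Fin n → ∀ i, Xs i), SameSeqType Ls Xs a b →
    SameType L' Ω (fun j => f (a j)) (fun j => f (b j))

end PaperDef

namespace PaperDef

open Computability

/-- An `Encodable` instance for bounded formulas, via `BoundedFormula.listEncode`. -/
instance instEncodableSigmaBoundedFormula (L : Language) (α : Type*) [Encodable α]
    [∀ i, Encodable (L.Functions i)] [∀ i, Encodable (L.Relations i)] :
    Encodable (Σ n, L.BoundedFormula α n) :=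
  Encodable.ofLeftInjection (fun φ => φ.2.listEncode)
    (fun l => (BoundedFormula.listDecode l).head?)
    (fun φ => by
      have h := BoundedFormula.listDecode_encode_list (L := L) (α := α) [φ]
      rw [List.flatMap_singleton] at h
      show (BoundedFormula.listDecode φ.2.listEncode).head? = some φ
      rw [h]
      rfl)

/-- An `Encodable` instance for formulas. -/
instance instEncodableFormula (L : Language) (α : Type*) [Encodable α]
    [∀ i, Encodable (L.Functions i)] [∀ i, Encodable (L.Relations i)] :
    Encodable (L.Formula α) :=
  Encodable.ofLeftInjection
    (fun φ => (⟨0, φ⟩ : Σ n, L.BoundedFormula α n))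
    (fun q => match q with
      | ⟨0, φ⟩ => some φ
      | ⟨_ + 1, _⟩ => none)
    (fun _ => rfl)

/-- A formula together with the number of its free variables.  A (quantifier-free) formula
`φᵢ` as in the input of the problems `Expr_pp`, `Expr_ex`, `Expr_ep`. -/
abbrev FormulaCode (L : Language) : Type _ :=
  (m : ℕ) × L.Formula (Fin m)

/-- The signature with one relation symbol for each formula in the list `l`,
of the corresponding arity. -/
def sigOf {L : Language} (l : List (FormulaCode L)) : Language :=
  ⟨fun _ => Empty, fun n => {i : Fin l.length // (l.get i).1 = n}⟩

/-- The structure `(D; R₁, …, Rₙ)` on the domain of `M` whose relations are defined by the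
formulas in the list `l`. -/
def structOf {L : Language} (M : Type*) [L.Structure M] (l : List (FormulaCode L)) :
    (sigOf l).Structure M where
  funMap := fun f _ => f.elim
  RelMap := fun r x => (l.get r.1).2.Realize (fun v => x (Fin.cast r.2 v))

/-- The relation defined by `φ₀` over `M` is primitive positive definable in the structure
whose relations are defined by the formulas in `l`. -/
def ExprYesPP {L : Language} (M : Type*) [L.Structure M]
    (φ₀ : FormulaCode L) (l : List (FormulaCode L)) : Prop :=
  letI := structOf M l
  ∃ ψ : (sigOf l).Formula (Fin φ₀.1), IsPrimitivePositive ψ ∧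
    ∀ x : Fin φ₀.1 → M, φ₀.2.Realize x ↔ ψ.Realize x

/-- The relation defined by `φ₀` over `M` is existentially definable in the structure
whose relations are defined by the formulas in `l`. -/
def ExprYesEx {L : Language} (M : Type*) [L.Structure M]
    (φ₀ : FormulaCode L) (l : List (FormulaCode L)) : Prop :=
  letI := structOf M l
  ∃ ψ : (sigOf l).Formula (Fin φ₀.1), IsExistential ψ ∧
    ∀ x : Fin φ₀.1 → M, φ₀.2.Realize x ↔ ψ.Realize x

/-- The relation defined by `φ₀` over `M` is existentially positively definable in the
structure whose relations are defined by the formulas in `l`. -/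
def ExprYesEP {L : Language} (M : Type*) [L.Structure M]
    (φ₀ : FormulaCode L) (l : List (FormulaCode L)) : Prop :=
  letI := structOf M l
  ∃ ψ : (sigOf l).Formula (Fin φ₀.1), IsExistentialPositive ψ ∧
    ∀ x : Fin φ₀.1 → M, φ₀.2.Realize x ↔ ψ.Realize x

/-- Decidability of the problem `Expr_pp(Γ)`: there is a computable function on codes which,
for every input consisting of quantifier-free formulas `φ₀` and `φ₁, …, φₙ`, decides whether
the relation defined by `φ₀` is primitive positive definable from the relations defined by
`φ₁, …, φₙ`. -/
def DecidableExprPP (L : Language) (M : Type*) [L.Structure M] [∀ i, Encodable (L.Functions i)]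
    [∀ i, Encodable (L.Relations i)] : Prop :=
  ∃ f : ℕ → Bool, Computable f ∧
    ∀ (φ₀ : FormulaCode L) (l : List (FormulaCode L)),
      BoundedFormula.IsQF φ₀.2 → (∀ p ∈ l, BoundedFormula.IsQF p.2) →
      (f (Encodable.encode (φ₀, l)) = true ↔ ExprYesPP M φ₀ l)

/-- Decidability of the problem `Expr_ex(Γ)`. -/
def DecidableExprEx (L : Language) (M : Type*) [L.Structure M] [∀ i, Encodable (L.Functions i)]
    [∀ i, Encodable (L.Relations i)] : Prop :=
  ∃ f : ℕ → Bool, Computable f ∧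
    ∀ (φ₀ : FormulaCode L) (l : List (FormulaCode L)),
      BoundedFormula.IsQF φ₀.2 → (∀ p ∈ l, BoundedFormula.IsQF p.2) →
      (f (Encodable.encode (φ₀, l)) = true ↔ ExprYesEx M φ₀ l)

/-- Decidability of the problem `Expr_ep(Γ)`. -/
def DecidableExprEP (L : Language) (M : Type*) [L.Structure M] [∀ i, Encodable (L.Functions i)]
    [∀ i, Encodable (L.Relations i)] : Prop :=
  ∃ f : ℕ → Bool, Computable f ∧
    ∀ (φ₀ : FormulaCode L) (l : List (FormulaCode L)),
      BoundedFormula.IsQF φ₀.2 → (∀ p ∈ l, BoundedFormula.IsQF p.2) →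
      (f (Encodable.encode (φ₀, l)) = true ↔ ExprYesEP M φ₀ l)

end PaperDef

namespace PaperDef

section Types

variable {L : Language} {M : Type} [L.Structure M]

/-- Two tuples, indexed by an arbitrary type, lie in the same orbit. -/
def SO (L : Language) {M : Type} [L.Structure M] {V : Type*} (x y : V → M) : Prop :=
  ∃ g : M ≃[L] M, ∀ i, g (x i) = y i

theorem SO.refl {V : Type*} (x : V → M) : SO L x x :=
  ⟨FirstOrder.Language.Equiv.refl L M, fun _ => rfl⟩

theorem SO.symm {V : Type*} {x y : V → M} (h : SO L x y) : SO L y x := by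
  obtain ⟨g, hg⟩ := h
  exact ⟨g.symm, fun i => by rw [← hg i]; exact g.symm_apply_apply _⟩

theorem SO.trans {V : Type*} {x y z : V → M} (h : SO L x y) (h' : SO L y z) : SO L x z := by
  obtain ⟨g, hg⟩ := h
  obtain ⟨g', hg'⟩ := h'
  exact ⟨g'.comp g, fun i => by simp [hg, hg']⟩

theorem SO.comp {V W : Type*} {x y : V → M} (h : SO L x y) (κ : W → V) :
    SO L (x ∘ κ) (y ∘ κ) := by
  obtain ⟨g, hg⟩ := h
  exact ⟨g, fun i => hg _⟩

theorem SO.eq_iff {V : Type*} {x y : V → M} (h : SO L x y) (i j : V) :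
    x i = x j ↔ y i = y j := by
  obtain ⟨g, hg⟩ := h
  rw [← hg, ← hg]
  exact g.injective.eq_iff.symm

theorem SO.rel_iff {a : ℕ} {x y : Fin a → M} (h : SO L x y) (r : L.Relations a) :
    Structure.RelMap r x ↔ Structure.RelMap r y := by
  obtain ⟨g, hg⟩ := h
  have : y = g ∘ x := funext fun i => (hg i).symm
  rw [this]
  exact (g.map_rel r x).symm

/-- Tuples with the same quantifier-free type are in the same orbit. -/
theorem SO.of_pattern [L.IsRelational] (hhom : L.IsUltrahomogeneous M) {V : Type*} [Finite V]
    (x y : V → M) (heq : ∀ i j, x i = x j ↔ y i = y j)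
    (hr : ∀ (a : ℕ) (r : L.Relations a) (κ : Fin a → V),
      Structure.RelMap r (x ∘ κ) ↔ Structure.RelMap r (y ∘ κ)) : SO L x y := by
  classical
  let S : L.Substructure M :=
    { carrier := Set.range x
      fun_mem := fun {n} f => isEmptyElim f }
  have hS : ∀ s : S, ∃ v, x v = s := fun s => s.2
  choose c hc using hS
  have hSfin : Finite S := Set.finite_range x
  let f : S ↪[L] M :=
    { toFun := fun s => y (c s)
      inj' := by
        intro s t hst
        have := (heq _ _).2 hst
        rw [hc, hc] at this
        exact Subtype.ext this
      map_fun' := fun {n} f => isEmptyElim f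
      map_rel' := by
        intro n r z
        have h1 := hr n r (c ∘ z)
        have h2 : x ∘ (c ∘ z) = fun i => (z i : M) := funext fun i => hc _
        rw [h2] at h1
        exact h1.symm }
  obtain ⟨g, hg⟩ := hhom S (Substructure.FG.of_finite) f
  refine ⟨g, fun i => ?_⟩
  have h1 : f ⟨x i, i, rfl⟩ = g (x i) := by rw [hg]; rfl
  rw [← h1]
  exact (heq _ _).1 (hc _)

/-- `z` realizes `u` locally. -/
def Rl (L : Language) {M : Type} [L.Structure M] {b : ℕ} {V : Type}
    (y : (Fin b → V) → (Fin b → M)) {W : Type} (u : W → V) (z : W → M) : Prop :=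
  ∀ ρ : Fin b → W, SO L (z ∘ ρ) (y (u ∘ ρ))

theorem Rl.comp {b : ℕ} {V : Type} {y : (Fin b → V) → (Fin b → M)} {W W' : Type} {u : W → V}
    {z : W → M} (h : Rl L y u z) (κ : W' → W) : Rl L y (u ∘ κ) (z ∘ κ) :=
  fun ρ => h (κ ∘ ρ)

theorem exists_retract {b : ℕ} {W : Type} [Finite W] [Nonempty W] (hW : Nat.card W ≤ b) :
    ∃ (ι : W → Fin b) (e : Fin b → W), ∀ w, e (ι w) = w := by
  let ι : W → Fin b := fun w => Fin.castLE hW (Finite.equivFin W w)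
  have hι : Function.Injective ι := fun w w' h => by
    have := Fin.castLE_injective hW h
    exact (Finite.equivFin W).injective this
  exact ⟨ι, Function.invFun ι, Function.leftInverse_invFun hι⟩

theorem Rl.exists {b : ℕ} {V : Type} {y : (Fin b → V) → (Fin b → M)}
    (hb : 1 ≤ b)
    (hy : ∀ s (π : Fin b → Fin b), SO L (y s ∘ π) (y (s ∘ π))) {W : Type} [Finite W]
    (hW : Nat.card W ≤ b) (u : W → V) : ∃ z, Rl L y u z := by
  rcases isEmpty_or_nonempty W with h | h
  · exact ⟨isEmptyElim, fun ρ => (h.false (ρ ⟨0, hb⟩)).elim⟩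
  · obtain ⟨ι, e, he⟩ := exists_retract hW
    refine ⟨y (u ∘ e) ∘ ι, fun ρ => ?_⟩
    have := hy (u ∘ e) (ι ∘ ρ)
    have h2 : (u ∘ e) ∘ ι ∘ ρ = u ∘ ρ := by
      funext i; simp [he]
    rw [h2] at this
    exact this

theorem Rl.so {b : ℕ} {V : Type} {y : (Fin b → V) → (Fin b → M)} {W : Type} [Finite W]
    (hW : Nat.card W ≤ b) {u : W → V} {z z' : W → M} (h : Rl L y u z) (h' : Rl L y u z') :
    SO L z z' := by
  rcases isEmpty_or_nonempty W with hh | hh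
  · exact ⟨FirstOrder.Language.Equiv.refl L M, fun i => isEmptyElim i⟩
  · obtain ⟨ι, e, he⟩ := exists_retract hW
    have h1 := ((h e).trans (h' e).symm).comp ι
    have h2 : ∀ t : W → M, (t ∘ e) ∘ ι = t := fun t => funext fun w => by simp [he]
    rwa [h2, h2] at h1

/-- Realization of locally realizable types, from finite boundedness. -/
theorem realize_of_local [L.IsRelational] (hhom : L.IsUltrahomogeneous M) {k : ℕ}
    (F : Fin k → CategoryTheory.Bundled.{0} L.Structure)
    (hF : ∀ i, Structure.FG L (F i))
    (hage : ∀ A : CategoryTheory.Bundled.{0} L.Structure, Structure.FG L A →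
      (A ∈ L.age M ↔ ∀ i, ¬ Nonempty ((F i) ↪[L] A)))
    {b : ℕ} (hb : 3 ≤ b) (hFb : ∀ i, Nat.card (F i) ≤ b)
    (har : ∀ a (_ : L.Relations a), 2 * a ≤ b) {V : Type} [Finite V]
    (y : (Fin b → V) → (Fin b → M))
    (hy : ∀ s (π : Fin b → Fin b), SO L (y s ∘ π) (y (s ∘ π))) :
    ∃ x : V → M, ∀ s : Fin b → V, SO L (x ∘ s) (y s) := by
  classical
  have hb1 : 1 ≤ b := by omega
  let EQ : V → V → Prop := fun i j => ∀ z : Fin 2 → M, Rl L y ![i, j] z → z 0 = z 1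
  have hEQ : ∀ {W : Type} [Finite W] (u : W → V) (z : W → M), Rl L y u z →
      ∀ w w', (z w = z w' ↔ EQ (u w) (u w')) := by
    intro W _ u z hz w w'
    have h1 := hz.comp ![w, w']
    have h2 : u ∘ ![w, w'] = ![u w, u w'] := by
      funext i; fin_cases i <;> rfl
    rw [h2] at h1
    constructor
    · intro h z' hz'
      have := (Rl.so (by simp; omega) h1 hz').eq_iff 0 1
      exact this.1 h
    · intro h
      exact h _ h1
  let St : Setoid V :=
    { r := EQ
      iseqv := by
        refine ⟨fun i => ?_, fun {i j} h => ?_, fun {i j l} h h' => ?_⟩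
        · obtain ⟨z, hz⟩ := Rl.exists hb1 hy (W := Unit) (by simp; omega) (fun _ => i)
          exact (hEQ _ z hz () ()).1 rfl
        · obtain ⟨z, hz⟩ := Rl.exists hb1 hy (W := Fin 2) (by simp; omega) ![i, j]
          exact (hEQ _ z hz 1 0).1 ((hEQ _ z hz 0 1).2 h).symm
        · obtain ⟨z, hz⟩ := Rl.exists hb1 hy (W := Fin 3) (by simp; omega) ![i, j, l]
          exact (hEQ _ z hz 0 2).1 (((hEQ _ z hz 0 1).2 h).trans ((hEQ _ z hz 1 2).2 h')) }
  have hrel : ∀ {W : Type} [Finite W] (u : W → V) (z : W → M), Rl L y u z →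
      ∀ {a : ℕ} (r : L.Relations a) (κ : Fin a → W), (Structure.RelMap r (z ∘ κ) ↔
        ∀ t, Rl L y (u ∘ κ) t → Structure.RelMap r t) := by
    intro W _ u z hz a r κ
    have ha := har a r
    have h1 := hz.comp κ
    constructor
    · intro h t ht
      exact ((Rl.so (by simp; omega) h1 ht).rel_iff r).1 h
    · intro h
      exact h _ h1
  let A : Type := Quotient St
  letI strA : L.Structure A :=
    { funMap := fun f => isEmptyElim f
      RelMap := fun {a} r z =>
        ∀ t, Rl L y (fun i => (z i).out) t → Structure.RelMap r t }
  have hAfin : Finite A := inferInstanceAs (Finite (Quotient St))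
  have hA : (⟨A, strA⟩ : CategoryTheory.Bundled.{0} L.Structure) ∈ L.age M := by
    rw [hage _ (Structure.FG.of_finite)]
    rintro i ⟨g⟩
    have hfin : Finite (F i) := (hF i).finite
    let g' : F i → A := g
    obtain ⟨z, hz⟩ := Rl.exists hb1 hy (hFb i) (fun w => (g' w).out)
    have hmem : F i ∈ L.age M := by
      refine ⟨hF i, ⟨⟨⟨z, ?_⟩, fun {n} f => isEmptyElim f, ?_⟩⟩⟩
      · intro w w' h
        have h1 := (hEQ _ z hz w w').1 h
        have h2 : (g' w) = (g' w') := by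
          rw [← Quotient.out_eq (g' w), ← Quotient.out_eq (g' w')]
          exact Quotient.sound h1
        exact g.injective h2
      · intro a r κ
        have h1 := hrel _ z hz r κ
        have h2 := g.map_rel r κ
        exact h1.trans h2
    exact ((hage _ (hF i)).1 hmem i) ⟨Embedding.refl L _⟩
  obtain ⟨-, ⟨e⟩⟩ := hA
  let e' : A ↪[L] M := e
  refine ⟨fun v => e' (Quotient.mk St v), fun s => ?_⟩
  have hs : Rl L y s (y s) := fun ρ => hy s ρ
  refine SO.of_pattern hhom _ _ (fun i j => ?_) (fun a r κ => ?_)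
  · rw [hEQ s _ hs i j]
    simp only [Function.comp]
    rw [e'.injective.eq_iff]
    exact Quotient.eq (r := St)
  · rw [hrel s _ hs r κ]
    have h1 := e'.map_rel r (fun i => Quotient.mk St (s (κ i)))
    refine Iff.trans h1 ?_
    show (∀ t, Rl L y (fun i => (Quotient.mk St (s (κ i))).out) t → Structure.RelMap r t) ↔ _
    have ha := har a r
    obtain ⟨z, hz⟩ := Rl.exists hb1 hy (W := Fin a ⊕ Fin a) (by simp; omega)
      (Sum.elim (fun i => (Quotient.mk St (s (κ i))).out) (s ∘ κ))
    have h2 := hrel _ z hz r Sum.inl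
    have h3 := hrel _ z hz r Sum.inr
    have h4 : z ∘ Sum.inl = z ∘ Sum.inr := by
      funext i
      refine (hEQ _ z hz (Sum.inl i) (Sum.inr i)).2 ?_
      exact Quotient.mk_out (s := St) (s (κ i))
    rw [h4] at h2
    exact h2.symm.trans h3

end Types
end PaperDef

namespace PaperDef

section Ramsey

variable {L : Language} {M : Type} [L.Structure M]

theorem rigid_tuple (hord : Ordered L M) {N : ℕ} {u v : Fin N → M} (h : SO L u v)
    (hr : Set.range u = Set.range v) : u = v := by
  classical
  obtain ⟨r, hlin⟩ := hord
  obtain ⟨g, hg⟩ := h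
  have hmon : ∀ a b : M, Structure.RelMap r ![a, b] ↔ Structure.RelMap r ![g a, g b] := by
    intro a b
    have := g.map_rel r ![a, b]
    have h2 : g ∘ ![a, b] = ![g a, g b] := by funext i; fin_cases i <;> rfl
    rw [h2] at this
    exact this.symm
  let _ : LinearOrder M :=
    { le := fun a b => Structure.RelMap r ![a, b]
      le_refl := fun a => hlin.toRefl.refl a
      le_trans := fun a b c => hlin.toIsTrans.trans a b c
      le_antisymm := fun a b => hlin.toAntisymm.antisymm a b
      le_total := fun a b => hlin.toTotal.total a b
      toDecidableLE := Classical.decRel _ }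
  have hle : ∀ a b : M, a ≤ b ↔ g a ≤ g b := hmon
  have hlt : ∀ a b : M, a < b ↔ g a < g b := fun a b => by
    rw [← not_le, ← not_le, hle]
  by_contra hne
  have hne' : ∃ n, u n ≠ v n := Function.ne_iff.1 hne
  let X : Set M := {x | x ∈ Set.range u ∧ g x ≠ x}
  have hXf : X.Finite := (Set.finite_range u).subset fun x hx => hx.1
  have hXn : X.Nonempty := by
    obtain ⟨n, hn⟩ := hne'
    exact ⟨u n, ⟨n, rfl⟩, by rw [hg]; exact hn.symm⟩
  obtain ⟨x, hx, hmin⟩ := Set.exists_min_image X id hXf hXn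
  have hmin' : ∀ z, z ∈ Set.range u → z < x → g z = z := by
    intro z hz hzx
    by_contra hcon
    exact absurd (hmin z ⟨hz, hcon⟩) (not_le.2 hzx)
  have hgx : g x ∈ Set.range u := by
    obtain ⟨n, rfl⟩ := hx.1
    rw [hr, hg]
    exact ⟨n, rfl⟩
  rcases lt_or_gt_of_ne hx.2 with h1 | h1
  · exact hx.2 (g.injective (hmin' _ hgx h1))
  · have hxv : x ∈ Set.range v := hr ▸ hx.1
    obtain ⟨n, hn⟩ := hxv
    rw [← hg] at hn
    rcases lt_trichotomy (u n) x with h2 | h2 | h2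
    · have := hmin' _ ⟨n, rfl⟩ h2
      rw [hn] at this
      exact absurd this.symm (ne_of_lt h2)
    · rw [h2] at hn
      exact hx.2 hn
    · have := (hlt _ _).1 h2
      rw [hn] at this
      exact absurd (this.trans h1) (lt_irrefl _)

/-- The substructure with a given carrier, in a relational language. -/
def subOf (L : Language) [L.IsRelational] {M : Type} [L.Structure M] (Y : Set M) :
    L.Substructure M where
  carrier := Y
  fun_mem := fun f => isEmptyElim f

theorem ramsey_tuples [L.IsRelational] (hord : Ordered L M) (hhom : L.IsUltrahomogeneous M)
    (hram : RamseyClass (L.age M)) {N : ℕ} (u : Fin N → M) (Y : Set M) (hY : Y.Finite)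
    (C : Type) [Finite C] [Nonempty C] :
    ∃ S : Set M, S.Finite ∧ ∀ χ : (Fin N → M) → C, ∃ g : M ≃[L] M, (∀ y ∈ Y, g y ∈ S) ∧
      ∀ u₁ u₂ : Fin N → M, (∀ i, u₁ i ∈ Y) → (∀ i, u₂ i ∈ Y) → SO L u u₁ → SO L u u₂ →
        χ (g ∘ u₁) = χ (g ∘ u₂) := by
  classical
  let Ps : L.Substructure M := subOf L (Set.range u)
  let Hs : L.Substructure M := subOf L Y
  have hPf : Finite Ps := Set.finite_range u
  have hHf : Finite Hs := hY
  let P : CategoryTheory.Bundled.{0} L.Structure := ⟨Ps, inferInstance⟩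
  let H : CategoryTheory.Bundled.{0} L.Structure := ⟨Hs, inferInstance⟩
  have hP : P ∈ L.age M := ⟨Structure.FG.of_finite (M := Ps), ⟨Ps.subtype⟩⟩
  have hH : H ∈ L.age M := ⟨Structure.FG.of_finite (M := Hs), ⟨Hs.subtype⟩⟩
  obtain ⟨S, ⟨hSfg, ⟨i⟩⟩, hS⟩ := hram (Nat.card C) Nat.card_pos H hH P hP
  have hSfin : Finite S := hSfg.finite
  refine ⟨Set.range i, Set.finite_range _, fun χ => ?_⟩
  have hup : ∀ n, u n ∈ Ps := fun n => ⟨n, rfl⟩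
  let t : {Q : L.Substructure S // Nonempty (P ≃[L] Q)} → (Fin N → M) :=
    fun Q n => i ((Classical.choice Q.2) (⟨u n, hup n⟩ : Ps) : S)
  obtain ⟨e, he⟩ := hS (fun Q => Finite.equivFin C (χ (t Q)))
  let ie : Hs ↪[L] M := i.comp e
  obtain ⟨g, hg⟩ := hhom Hs Substructure.FG.of_finite ie
  have hge : ∀ y (hy : y ∈ Y), g y = i (e (⟨y, hy⟩ : Hs)) := by
    intro y hy
    have : ie ⟨y, hy⟩ = g y := by rw [hg]; rfl
    rw [← this]; rfl
  refine ⟨g, fun y hy => by rw [hge y hy]; exact ⟨_, rfl⟩, ?_⟩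
  have key : ∀ u₁ : Fin N → M, (∀ n, u₁ n ∈ Y) → SO L u u₁ →
      ∃ Q : {Q : L.Substructure S // Nonempty (P ≃[L] Q)},
        (Q.1 : Set S) ⊆ Set.range e ∧ t Q = g ∘ u₁ := by
    intro u₁ hu₁ hso
    let Q : L.Substructure S := subOf L (Set.range fun n => e (⟨u₁ n, hu₁ n⟩ : Hs))
    obtain ⟨α, hα⟩ := hso
    have hmem : ∀ p : Ps, α p ∈ Y := by
      rintro ⟨_, n, rfl⟩
      rw [hα]; exact hu₁ n
    have hmemQ : ∀ p : Ps, e (⟨α p, hmem p⟩ : Hs) ∈ Q := by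
      rintro ⟨_, n, rfl⟩
      exact ⟨n, congrArg (fun h : Hs => e h) (Subtype.ext (hα n).symm)⟩
    let f : Ps → Q := fun p => ⟨e (⟨α p, hmem p⟩ : Hs), hmemQ p⟩
    have hf : Function.Bijective f := by
      constructor
      · intro p p' hpp
        have h1 : e (⟨α p, hmem p⟩ : Hs) = e (⟨α p', hmem p'⟩ : Hs) := congrArg Subtype.val hpp
        have h2 := congrArg Subtype.val (e.injective h1)
        exact Subtype.ext (α.injective h2)
      · rintro ⟨_, n, rfl⟩
        refine ⟨⟨u n, hup n⟩, Subtype.ext ?_⟩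
        exact congrArg (fun h : Hs => e h) (Subtype.ext (hα n))
    let E : Ps ≃[L] Q :=
      { toEquiv := Equiv.ofBijective f hf
        map_fun' := fun {n} f => isEmptyElim f
        map_rel' := by
          intro n r z
          have h1 := e.map_rel r (fun j => (⟨α (z j), hmem (z j)⟩ : Hs))
          have h2 := α.map_rel r (fun j => (z j : M))
          exact h1.trans h2 }
    let QQ : {Q : L.Substructure S // Nonempty (P ≃[L] Q)} := ⟨Q, ⟨E⟩⟩
    refine ⟨QQ, ?_, ?_⟩
    · rintro _ ⟨n, rfl⟩
      exact ⟨_, rfl⟩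
    · let h : Ps ≃[L] Q := Classical.choice QQ.2
      have ht : ∀ n, t QQ n = i (h ⟨u n, hup n⟩ : S) := fun n => rfl
      have hso1 : SO L u (t QQ) := by
        refine SO.of_pattern hhom _ _ (fun a b => ?_) (fun a r κ => ?_)
        · rw [ht, ht, i.injective.eq_iff, Subtype.val_injective.eq_iff, h.injective.eq_iff,
            Subtype.mk.injEq]
        · have h1 := i.map_rel r (fun j => (h ⟨u (κ j), hup (κ j)⟩ : S))
          have h2 := h.map_rel r (fun j => (⟨u (κ j), hup (κ j)⟩ : Ps))
          exact (h1.trans h2).symm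
      have hso2 : SO L u (g ∘ u₁) := SO.trans ⟨α, hα⟩ ⟨g, fun _ => rfl⟩
      refine rigid_tuple hord (hso1.symm.trans hso2) ?_
      ext m
      constructor
      · rintro ⟨n, rfl⟩
        rw [ht]
        obtain ⟨n', hn'⟩ := (h ⟨u n, hup n⟩).2
        refine ⟨n', ?_⟩
        rw [← hn']
        exact hge _ _
      · rintro ⟨n, rfl⟩
        obtain ⟨⟨_, n', rfl⟩, hp⟩ := h.surjective ⟨e (⟨u₁ n, hu₁ n⟩ : Hs), ⟨n, rfl⟩⟩
        refine ⟨n', ?_⟩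
        rw [ht]
        have : ((h ⟨u n', hup n'⟩ : Q) : S) = e (⟨u₁ n, hu₁ n⟩ : Hs) := congrArg Subtype.val hp
        rw [this]
        exact (hge _ _).symm
  intro u₁ u₂ h1 h2 hs1 hs2
  obtain ⟨Q₁, hQ₁, ht₁⟩ := key u₁ h1 hs1
  obtain ⟨Q₂, hQ₂, ht₂⟩ := key u₂ h2 hs2
  have := (Finite.equivFin C).injective (he Q₁ Q₂ hQ₁ hQ₂)
  rw [← ht₁, ← ht₂]
  exact this

/-- An abstract Ramsey property for a set of self-maps and an equivalence. -/
def RA {Ω : Type} (G : Set (Ω → Ω)) (rel : Ω → Ω → Prop) : Prop :=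
  ∀ (C : Type) [Finite C] [Nonempty C] (F : Set Ω), F.Finite → ∃ E : Set Ω, E.Finite ∧
    ∀ χ : Ω → C, ∃ g ∈ G, (∀ x ∈ F, g x ∈ E) ∧
      ∀ x ∈ F, ∀ y ∈ F, rel x y → χ (g x) = χ (g y)

theorem RA.of_single {Ω : Type} (G : Set (Ω → Ω)) (rel : Ω → Ω → Prop)
    (hrefl : ∀ x, rel x x)
    (hid : id ∈ G)
    (hcomp : ∀ g ∈ G, ∀ h ∈ G, g ∘ h ∈ G) (hG : ∀ g ∈ G, ∀ x y, rel x y → rel x (g y))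
    (h : ∀ (C : Type) [Finite C] [Nonempty C] (F : Set Ω) (x₀ : Ω), F.Finite →
      ∃ E : Set Ω, E.Finite ∧ ∀ χ : Ω → C, ∃ g ∈ G, (∀ x ∈ F, g x ∈ E) ∧
        ∀ x ∈ F, ∀ y ∈ F, rel x₀ x → rel x₀ y → χ (g x) = χ (g y)) : RA G rel := by
  intro C _ _ F hF
  have main : ∀ T : Finset Ω, ∃ E : Set Ω, E.Finite ∧ ∀ χ : Ω → C, ∃ g ∈ G, (∀ x ∈ F, g x ∈ E) ∧
        ∀ x₀ ∈ T, ∀ x ∈ F, ∀ y ∈ F, rel x₀ x → rel x₀ y → χ (g x) = χ (g y) := by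
    classical
    intro T
    induction T using Finset.induction_on with
    | empty => exact ⟨F, hF, fun χ => ⟨id, hid, fun x hx => hx, by simp⟩⟩
    | insert x₀ T _ ih =>
      obtain ⟨E', hE', ih⟩ := ih
      obtain ⟨E, hE, h1⟩ := h C E' x₀ hE'
      refine ⟨E, hE, fun χ => ?_⟩
      obtain ⟨g, hgG, hg1, hg2⟩ := h1 χ
      obtain ⟨g', hgG', hg1', hg2'⟩ := ih (χ ∘ g)
      refine ⟨g ∘ g', hcomp _ hgG _ hgG', fun x hx => hg1 _ (hg1' x hx), ?_⟩
      intro z hz x hx y hy hzx hzy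
      rcases Finset.mem_insert.1 hz with rfl | hz
      · exact hg2 _ (hg1' x hx) _ (hg1' y hy) (hG _ hgG' _ _ hzx) (hG _ hgG' _ _ hzy)
      · exact hg2' z hz x hx y hy hzx hzy
  obtain ⟨E, hE, h1⟩ := main hF.toFinset
  refine ⟨E, hE, fun χ => ?_⟩
  obtain ⟨g, hgG, hg1, hg2⟩ := h1 χ
  exact ⟨g, hgG, hg1, fun x hx y hy hxy =>
    hg2 x (hF.mem_toFinset.2 hx) x hx y hy (hrefl x) hxy⟩

theorem RA.prod {Ω : Type} (C : Type) [Finite C] [Nonempty C] :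
    ∀ {k : ℕ} (G : Fin k → Set (Ω → Ω)) (rel : Fin k → Ω → Ω → Prop)
    (_ : ∀ j, RA (G j) (rel j))
    (F : Fin k → Set Ω) (_ : ∀ j, (F j).Finite),
    ∃ E : Fin k → Set Ω, (∀ j, (E j).Finite) ∧ ∀ χ : (Fin k → Ω) → C,
      ∃ g : Fin k → Ω → Ω, (∀ j, g j ∈ G j) ∧ (∀ j, ∀ x ∈ F j, g j x ∈ E j) ∧
        ∀ x y : Fin k → Ω, (∀ j, x j ∈ F j) → (∀ j, y j ∈ F j) →
          (∀ j, rel j (x j) (y j)) → χ (fun j => g j (x j)) = χ (fun j => g j (y j)) := by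
  intro k
  induction k generalizing C with
  | zero =>
    intro G rel _ F _
    exact ⟨fun j => j.elim0, fun j => j.elim0, fun χ => ⟨fun j => j.elim0, fun j => j.elim0,
      fun j => j.elim0, fun x y _ _ _ => congrArg χ (funext fun j => j.elim0)⟩⟩
  | succ k ih =>
    intro G rel h F hF
    let B : Set (Fin k → Ω) := Set.pi Set.univ (fun j => F j.succ)
    have hB : Finite B := Set.Finite.pi' (t := fun j => F j.succ) (fun j => hF j.succ) |>.subset
      (fun x hx j => hx j (Set.mem_univ _))
    obtain ⟨E0, hE0, h0⟩ := h 0 (B → C) (F 0) (hF 0)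
    have : Finite E0 := hE0
    obtain ⟨E, hE, h1⟩ := ih (E0 → C) (fun j => G j.succ) (fun j => rel j.succ)
      (fun j => h j.succ) (fun j => F j.succ) (fun j => hF j.succ)
    refine ⟨Fin.cons E0 E, fun j => ?_, fun χ => ?_⟩
    · refine Fin.cases ?_ (fun j => ?_) j
      · exact hE0
      · exact hE j
    · obtain ⟨g, hgG, hgE, hg⟩ := h1 (fun y x => χ (Fin.cons x.1 y))
      obtain ⟨g0, hg0G, hg0E, hg0⟩ := h0 (fun x y => χ (Fin.cons x (fun j => g j (y.1 j))))
      have hcons : ∀ x : Fin (k + 1) → Ω,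
          (fun j => (Fin.cons g0 g : Fin (k + 1) → Ω → Ω) j (x j)) =
            Fin.cons (g0 (x 0)) (fun j => g j (x j.succ)) := by
        intro x
        funext j
        refine Fin.cases ?_ (fun j => ?_) j <;> simp
      refine ⟨Fin.cons g0 g, fun j => ?_, fun j => ?_, fun x y hx hy hxy => ?_⟩
      · refine Fin.cases ?_ (fun j => ?_) j
        · exact hg0G
        · exact hgG j
      · refine Fin.cases ?_ (fun j => ?_) j
        · exact hg0E
        · exact hgE j
      · rw [hcons, hcons]
        have e1 := hg0 (x 0) (hx 0) (y 0) (hy 0) (hxy 0)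
        have e2 := congrFun e1 ⟨fun j => x j.succ, fun j _ => hx j.succ⟩
        have e3 := hg (fun j => x j.succ) (fun j => y j.succ) (fun j => hx j.succ)
          (fun j => hy j.succ) (fun j => hxy j.succ)
        have e4 := congrFun e3 ⟨g0 (y 0), hg0E _ (hy 0)⟩
        exact e2.trans e4

/-- Composition with automorphisms fixing the tuple `c`. -/
def fixMaps (L : Language) {M : Type} [L.Structure M] {p : ℕ} (c : Fin p → M) :
    Set ((Fin p → M) → (Fin p → M)) :=
  {G | ∃ g : M ≃[L] M, (∀ i, g (c i) = c i) ∧ G = fun x => g ∘ x}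

/-- Same type over the tuple `c`. -/
def relOver (L : Language) {M : Type} [L.Structure M] {p : ℕ} (c : Fin p → M)
    (x y : Fin p → M) : Prop :=
  SO L (Fin.append x c) (Fin.append y c)

theorem append_comp {A B : Type} {p : ℕ} (g : A → B) (x c : Fin p → A) :
    g ∘ Fin.append x c = Fin.append (g ∘ x) (g ∘ c) := by
  funext i
  refine Fin.addCases (fun i => ?_) (fun i => ?_) i <;>
    simp only [Function.comp, Fin.append_left, Fin.append_right]

theorem RA.over [L.IsRelational] (hord : Ordered L M) (hhom : L.IsUltrahomogeneous M)
    (hram : RamseyClass (L.age M)) {p : ℕ} (c : Fin p → M) :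
    RA (fixMaps L c) (relOver L c) := by
  classical
  refine RA.of_single _ _ (fun x => SO.refl _) ⟨FirstOrder.Language.Equiv.refl L M,
    fun _ => rfl, rfl⟩ ?_ ?_ ?_
  · rintro _ ⟨g, hg, rfl⟩ _ ⟨h, hh, rfl⟩
    exact ⟨g.comp h, fun i => by simp [hh, hg], rfl⟩
  · rintro _ ⟨g, hg, rfl⟩ x y hxy
    refine hxy.trans ⟨g, fun i => ?_⟩
    have h1 := congrFun (append_comp g y c) i
    have h2 : g ∘ c = c := funext hg
    rw [h2] at h1
    exact h1
  · intro C _ _ F x₀ hF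
    let Y : Set M := (⋃ x ∈ F, Set.range x) ∪ Set.range c
    have hY : Y.Finite := (hF.biUnion fun x _ => Set.finite_range x).union (Set.finite_range c)
    obtain ⟨S, hS, h⟩ := ramsey_tuples hord hhom hram (Fin.append x₀ c) Y hY C
    let al : (Fin p → M) → (M ≃[L] M) := fun c' =>
      if h : ∃ g : M ≃[L] M, ∀ i, g (c i) = c' i then h.choose
      else FirstOrder.Language.Equiv.refl L M
    have hal : ∀ c', (∃ g : M ≃[L] M, ∀ i, g (c i) = c' i) → ∀ i, al c' (c i) = c' i := by
      intro c' h
      simp only [al, dif_pos h]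
      exact h.choose_spec
    have hSp : {z : Fin p → M | ∀ i, z i ∈ S}.Finite := Set.Finite.pi' fun _ => hS
    let E : Set (Fin p → M) :=
      (fun q : (Fin p → M) × (Fin p → M) => (al q.1).symm ∘ q.2) ''
        ({z : Fin p → M | ∀ i, z i ∈ S} ×ˢ {z : Fin p → M | ∀ i, z i ∈ S})
    refine ⟨E, (hSp.prod hSp).image _, fun χ => ?_⟩
    obtain ⟨g, hgS, hg⟩ := h (fun v => χ ((al (fun i => v (Fin.natAdd p i))).symm ∘
      (fun i => v (Fin.castAdd p i))))
    have hcY : ∀ i, c i ∈ Y := fun i => Or.inr ⟨i, rfl⟩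
    have hxY : ∀ x ∈ F, ∀ i, x i ∈ Y := fun x hx i =>
      Or.inl (Set.mem_biUnion hx ⟨i, rfl⟩)
    let a := al (g ∘ c)
    have ha : ∀ i, a (c i) = g (c i) := hal (g ∘ c) ⟨g, fun _ => rfl⟩
    refine ⟨fun x => (a.symm.comp g) ∘ x, ⟨a.symm.comp g, fun i => ?_, rfl⟩, ?_, ?_⟩
    · simp only [FirstOrder.Language.Equiv.comp_apply]
      rw [← ha]
      exact a.symm_apply_apply _
    · intro x hx
      exact ⟨(g ∘ c, g ∘ x), ⟨fun i => hgS _ (hcY i), fun i => hgS _ (hxY x hx i)⟩, rfl⟩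
    · intro x hx y hy hx0 hy0
      have hmemY : ∀ x ∈ F, ∀ i, Fin.append x c i ∈ Y := by
        intro x hx i
        refine Fin.addCases (fun i => ?_) (fun i => ?_) i
        · simpa using hxY x hx i
        · rw [Fin.append_right]; exact hcY i
      have := hg (Fin.append x c) (Fin.append y c) (hmemY x hx) (hmemY y hy) hx0 hy0
      simp only [Function.comp_def, Fin.append_left, Fin.append_right] at this
      exact this

end Ramsey
end PaperDef

namespace PaperDef

section PP

variable {L : Language} {M : Type} [L.Structure M]

/-- `f` preserves all relations, on tuples from the set `X`. -/
def PresOn (L : Language) {M : Type} [L.Structure M] {k : ℕ} (X : Set M)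
    (f : (Fin k → M) → M) : Prop :=
  ∀ (n : ℕ) (r : L.Relations n) (rows : Fin k → Fin n → M), (∀ j i, rows j i ∈ X) →
    (∀ j, Structure.RelMap r (rows j)) → Structure.RelMap r (fun i => f (fun j => rows j i))

theorem term_realize_f [L.IsRelational] {β : Type} (t : L.Term β) {k : ℕ}
    (f : (Fin k → M) → M) (w : Fin k → β → M) :
    t.realize (fun b => f (fun j => w j b)) = f (fun j => t.realize (w j)) := by
  cases t with
  | var b => rfl
  | func F _ => exact isEmptyElim F

theorem elim_f {α : Type} {k n : ℕ} (f : (Fin k → M) → M) (v : Fin k → α → M)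
    (xs : Fin k → Fin n → M) :
    Sum.elim (fun a => f (fun j => v j a)) (fun i => f (fun j => xs j i)) =
      fun b => f (fun j => Sum.elim (v j) (xs j) b) := by
  funext b
  cases b <;> rfl

theorem pp_local [L.IsRelational] {α : Type} {k : ℕ} (v : Fin k → α → M) {n : ℕ}
    (ψ : L.BoundedFormula α n) (hψ : IsPrimitivePositive ψ) :
    ∀ (xs : Fin k → Fin n → M) (_ : ∀ j, ψ.Realize (v j) (xs j)),
    ∃ X : Set M, X.Finite ∧ ∀ f : (Fin k → M) → M, PresOn L X f →
      ψ.Realize (fun a => f (fun j => v j a)) (fun i => f (fun j => xs j i)) := by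
  induction hψ with
  | atomic h =>
    intro xs hr
    cases h with
    | equal t₁ t₂ =>
      refine ⟨∅, Set.finite_empty, fun f _ => ?_⟩
      simp only [BoundedFormula.realize_bdEqual] at hr ⊢
      rw [elim_f, term_realize_f, term_realize_f]
      exact congrArg f (funext hr)
    | rel R ts =>
      refine ⟨⋃ j, Set.range fun i => (ts i).realize (Sum.elim (v j) (xs j)),
        Set.finite_iUnion fun j => Set.finite_range _, fun f hf => ?_⟩
      simp only [BoundedFormula.realize_rel] at hr ⊢
      rw [elim_f]
      simp only [term_realize_f]
      exact hf _ R (fun j i => (ts i).realize (Sum.elim (v j) (xs j)))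
        (fun j i => Set.mem_iUnion.2 ⟨j, i, rfl⟩) hr
  | inf _ _ ih1 ih2 =>
    intro xs hr
    simp only [BoundedFormula.realize_inf] at hr ⊢
    obtain ⟨X1, hX1, h1⟩ := ih1 xs (fun j => (hr j).1)
    obtain ⟨X2, hX2, h2⟩ := ih2 xs (fun j => (hr j).2)
    refine ⟨X1 ∪ X2, hX1.union hX2, fun f hf => ⟨h1 f ?_, h2 f ?_⟩⟩
    · exact fun n r rows hm => hf n r rows (fun j i => Or.inl (hm j i))
    · exact fun n r rows hm => hf n r rows (fun j i => Or.inr (hm j i))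
  | ex _ ih =>
    intro xs hr
    simp only [BoundedFormula.realize_ex] at hr ⊢
    choose y hy using hr
    obtain ⟨X, hX, h⟩ := ih (fun j => Fin.snoc (xs j) (y j)) hy
    refine ⟨X, hX, fun f hf => ⟨f y, ?_⟩⟩
    convert h f hf using 1
    funext i
    refine Fin.lastCases ?_ (fun i => ?_) i <;> simp

/-- Conjunction of a list of formulas, with a given first conjunct. -/
def conjL {α : Type} {n : ℕ} (φ : L.BoundedFormula α n) :
    List (L.BoundedFormula α n) → L.BoundedFormula α n
  | [] => φ
  | ψ :: l => ψ ⊓ conjL φ l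

theorem realize_conjL {α : Type} {n : ℕ} (φ : L.BoundedFormula α n)
    (l : List (L.BoundedFormula α n)) (v : α → M) (xs : Fin n → M) :
    (conjL φ l).Realize v xs ↔ φ.Realize v xs ∧ ∀ ψ ∈ l, ψ.Realize v xs := by
  induction l with
  | nil => simp [conjL]
  | cons ψ l ih =>
    simp only [conjL, BoundedFormula.realize_inf, ih, List.mem_cons, forall_eq_or_imp]
    tauto

theorem pp_conjL {α : Type} {n : ℕ} (φ : L.BoundedFormula α n) (hφ : φ.IsAtomic)
    (l : List (L.BoundedFormula α n)) (hl : ∀ ψ ∈ l, ψ.IsAtomic) :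
    IsPrimitivePositive (conjL φ l) := by
  induction l with
  | nil => exact .atomic hφ
  | cons ψ l ih =>
    exact .inf (.atomic (hl ψ (by simp))) (ih fun χ hχ => hl χ (by simp [hχ]))

theorem pp_exs {α : Type} {n : ℕ} (φ : L.BoundedFormula α n) (hφ : IsPrimitivePositive φ) :
    IsPrimitivePositive φ.exs := by
  induction n with
  | zero => exact hφ
  | succ n ih => exact ih _ (.ex hφ)

theorem exists_poly [L.IsRelational] [Finite (Σ n, L.Relations n)] {m : ℕ}
    (R₀ : (Fin m → M) → Prop)
    (hnot : ¬ ∃ ψ : L.Formula (Fin m), IsPrimitivePositive ψ ∧ ∀ x, R₀ x ↔ ψ.Realize x)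
    {k : ℕ} (c : Fin k → Fin m → M)
    (hc : ∀ x, R₀ x → ∃ j, ∃ g : M → M, (∀ n (r : L.Relations n) (y : Fin n → M),
      Structure.RelMap r y → Structure.RelMap r (g ∘ y)) ∧ g ∘ c j = x)
    (X : Set M) (hX : X.Finite) (hXn : X.Nonempty) (hcX : ∀ j i, c j i ∈ X) :
    ∃ f : (Fin k → M) → M, PresOn L X f ∧ ¬ R₀ (fun i => f (fun j => c j i)) := by
  classical
  by_contra hcon
  push Not at hcon
  apply hnot
  have : Finite X := hX
  have : Nonempty X := hXn.to_subtype
  let E := Finite.equivFin (Fin k → X)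
  let N := Nat.card (Fin k → X)
  let yv : Fin N → L.Term (Fin m ⊕ Fin N) := fun e => Term.var (Sum.inr e)
  let e0 : Fin N := E (fun _ => Classical.arbitrary X)
  let base : L.BoundedFormula (Fin m) N := Term.bdEqual (yv e0) (yv e0)
  let ats : Set (L.BoundedFormula (Fin m) N) :=
    (Set.range fun i : Fin m =>
      Term.bdEqual (Term.var (Sum.inl i)) (yv (E fun j => ⟨c j i, hcX j i⟩))) ∪
    ⋃ r : (Σ n, L.Relations n), (fun t : Fin r.1 → Fin N => r.2.boundedFormula (fun i => yv (t i))) ''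
      {t | ∀ j, Structure.RelMap r.2 (fun i => ((E.symm (t i)) j : M))}
  have hats : ats.Finite := (Set.finite_range _).union
    (Set.finite_iUnion fun r => (Set.toFinite _).image _)
  let ψ := conjL base hats.toFinset.toList
  refine ⟨ψ.exs, pp_exs _ (pp_conjL _ (.equal _ _) _ ?_), fun x => ?_⟩
  · intro χ hχ
    simp only [Finset.mem_toList, Set.Finite.mem_toFinset] at hχ
    rcases hχ with ⟨i, rfl⟩ | hχ
    · exact .equal _ _
    · obtain ⟨r, t, ht, rfl⟩ := Set.mem_iUnion.1 hχ
      exact .rel _ _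
  · have hex : (BoundedFormula.exs ψ : L.Formula (Fin m)).Realize x ↔ ∃ ys : Fin N → M,
        (∀ i, x i = ys (E fun j => ⟨c j i, hcX j i⟩)) ∧
        ∀ (r : Σ n, L.Relations n) (t : Fin r.1 → Fin N),
          (∀ j, Structure.RelMap r.2 (fun i => ((E.symm (t i)) j : M))) →
          Structure.RelMap r.2 (ys ∘ t) := by
      rw [BoundedFormula.realize_exs]
      refine exists_congr fun ys => ?_
      rw [realize_conjL]
      simp only [Finset.mem_toList, Set.Finite.mem_toFinset]
      constructor
      · rintro ⟨_, h⟩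
        refine ⟨fun i => ?_, fun r t ht => ?_⟩
        · have := h _ (Or.inl ⟨i, rfl⟩)
          simpa [yv] using this
        · have := h _ (Or.inr (Set.mem_iUnion.2 ⟨r, t, ht, rfl⟩))
          simpa [yv, BoundedFormula.realize_rel, Function.comp_def] using this
      · rintro ⟨h1, h2⟩
        refine ⟨by simp [base], fun χ hχ => ?_⟩
        rcases hχ with ⟨i, rfl⟩ | hχ
        · simpa [yv] using h1 i
        · obtain ⟨r, t, ht, rfl⟩ := Set.mem_iUnion.1 hχ
          have := h2 r t ht
          simpa [yv, BoundedFormula.realize_rel, Function.comp_def] using this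
    rw [hex]
    constructor
    · intro hx
      obtain ⟨j, g, hg, rfl⟩ := hc x hx
      refine ⟨fun e => g ((E.symm e) j), fun i => by simp, fun r t ht => ?_⟩
      exact hg _ r.2 _ (ht j)
    · rintro ⟨ys, h1, h2⟩
      let f : (Fin k → M) → M := fun z =>
        if h : ∀ j, z j ∈ X then ys (E fun j => ⟨z j, h j⟩) else Classical.choice ⟨ys e0⟩
      have hf : PresOn L X f := by
        intro n r rows hm hr
        have := h2 ⟨n, r⟩ (fun i => E fun j => ⟨rows j i, hm j i⟩) (fun j => by simpa using hr j)
        convert this using 1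
        funext i
        simp [f, hm]
      have := hcon f hf
      convert this using 1
      funext i
      rw [h1]
      simp [f, hcX]

instance (l : List (FormulaCode L)) : (sigOf l).IsRelational :=
  fun _ => inferInstanceAs (IsEmpty Empty)

instance (l : List (FormulaCode L)) : Finite (Σ n, (sigOf l).Relations n) := by
  refine Finite.of_injective (β := Fin l.length) (fun r => r.2.1) ?_
  rintro ⟨n, i, rfl⟩ ⟨n', i', rfl⟩ h
  obtain rfl : i = i' := h
  rfl

end PP
end PaperDef

namespace PaperDef

section Crit

variable {L L' : Language} {M : Type} [L.Structure M] [L'.Structure M]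

/-- Local realizability: consistent families of `b`-types are realized. -/
def RealB (L : Language) (M : Type) [L.Structure M] (b : ℕ) : Prop :=
  ∀ (V : Type) [Finite V] (y : (Fin b → V) → (Fin b → M)),
    (∀ s (π : Fin b → Fin b), SO L (y s ∘ π) (y (s ∘ π))) →
    ∃ x : V → M, ∀ s, SO L (x ∘ s) (y s)

theorem SO.of_local [L.IsRelational] (hhom : L.IsUltrahomogeneous M) {b : ℕ} (hb : 3 ≤ b)
    (har : ∀ a (_ : L.Relations a), 2 * a ≤ b) {V : Type*} [Finite V] (x y : V → M)
    (h : ∀ s : Fin b → V, SO L (x ∘ s) (y ∘ s)) : SO L x y := by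
  refine SO.of_pattern hhom x y (fun i j => ?_) (fun a r κ => ?_)
  · have := (h (fun t => if t.1 = 0 then i else j)).eq_iff ⟨0, by omega⟩ ⟨1, by omega⟩
    simpa using this
  · by_cases ha : a = 0
    · subst ha
      have h1 : y ∘ κ = x ∘ κ := funext fun i => i.elim0
      rw [h1]
    · have hab : a ≤ b := by have := har a r; omega
      let s : Fin b → V := fun t => if h : t.1 < a then κ ⟨t.1, h⟩ else κ ⟨0, by omega⟩
      have h1 := ((h s).comp (Fin.castLE hab)).rel_iff r
      have h2 : s ∘ Fin.castLE hab = κ := by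
        funext i
        simp [s]
      rw [← h2]
      exact h1

/-- The formula holds for the first entries of the tuple. -/
def Sat {p : ℕ} (x : Fin p → M) (φ : FormulaCode L') : Prop :=
  ∀ h : φ.1 ≤ p, φ.2.Realize (x ∘ Fin.castLE h)

/-- The `L'`-structure is invariant under the automorphisms of the `L`-structure. -/
def Inv (L L' : Language) (M : Type) [L.Structure M] [L'.Structure M] : Prop :=
  ∀ (φ : FormulaCode L') (x y : Fin φ.1 → M), SO L x y → φ.2.Realize x → φ.2.Realize y

theorem Inv.sat (hinv : Inv L L' M) {p : ℕ} {x y : Fin p → M} (h : SO L x y) (φ : FormulaCode L') :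
    Sat x φ → Sat y φ := fun h1 hp => hinv φ _ _ (h.comp (Fin.castLE hp)) (h1 hp)

/-- Existence of a canonical partial polymorphism violating `φ₀`. -/
def Crit (L : Language) {L' : Language} (M : Type) [L.Structure M] [L'.Structure M] (p Q : ℕ)
    (φ₀ : FormulaCode L') (l : List (FormulaCode L')) : Prop :=
  ∃ k ≤ Q, ∃ (c : Fin k → Fin p → M) (ξ : (Fin k → Fin p → M) → (Fin p → M)),
    (∀ j, Sat (c j) φ₀) ∧
    (∀ x x' : Fin k → Fin p → M, (∀ j, relOver L (c j) (x j) (x' j)) → SO L (ξ x) (ξ x')) ∧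
    (∀ (x : Fin k → Fin p → M) (π : Fin p → Fin p), SO L (ξ (fun j => x j ∘ π)) (ξ x ∘ π)) ∧
    (∀ φ ∈ l, ∀ x : Fin k → Fin p → M, (∀ j, Sat (x j) φ) → Sat (ξ x) φ) ∧
    ¬ Sat (ξ c) φ₀

theorem relOver.comp {p : ℕ} {c x x' : Fin p → M} (h : relOver L c x x') (π : Fin p → Fin p) :
    relOver L c (x ∘ π) (x' ∘ π) := by
  have := SO.comp h (Fin.append (Fin.castAdd p ∘ π) (Fin.natAdd p))
  have e : ∀ x : Fin p → M, Fin.append x c ∘ (Fin.append (Fin.castAdd p ∘ π) (Fin.natAdd p)) =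
      Fin.append (x ∘ π) c := by
    intro x
    rw [append_comp]
    congr 1
    · funext i
      simp only [Function.comp, Fin.append_left]
    · funext i
      simp only [Function.comp, Fin.append_right]
  rwa [e, e] at this

theorem crit_of_not_pp [L.IsRelational] [Nonempty M]
    (hord : Ordered L M) (hhom : L.IsUltrahomogeneous M)
    (hram : RamseyClass (L.age M)) (hinv : Inv L L' M) {p Q Q2 : ℕ}
    (code : (Fin p → M) → Fin Q) (hcode : ∀ x y, code x = code y ↔ SO L x y)
    (code2 : (Fin (p + p) → M) → Fin Q2) (hcode2 : ∀ x y, code2 x = code2 y ↔ SO L x y)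
    (φ₀ : FormulaCode L') (l : List (FormulaCode L'))
    (hp₀ : φ₀.1 ≤ p) (hp : ∀ φ ∈ l, φ.1 ≤ p)
    (h : ¬ ExprYesPP M φ₀ l) : Crit L M p Q φ₀ l := by
  classical
  let _ := structOf M l
  obtain ⟨m₀⟩ := ‹Nonempty M›
  -- representatives
  let S : Set (Fin Q) := {q | ∃ x, code x = q ∧ Sat x φ₀}
  have hk : Nat.card S ≤ Q := by
    have := Finite.card_subtype_le (fun q : Fin Q => q ∈ S)
    simpa using this
  let E := Finite.equivFin S
  have hS : ∀ s : S, ∃ x, code x = s ∧ Sat x φ₀ := fun s => s.2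
  choose rp hrp1 hrp2 using hS
  let k := Nat.card S
  let c : Fin k → Fin p → M := fun j => rp (E.symm j)
  have hcS : ∀ j, Sat (c j) φ₀ := fun j => hrp2 _
  have hcov : ∀ x : Fin p → M, Sat x φ₀ → ∃ j, SO L (c j) x := by
    intro x hx
    refine ⟨E ⟨code x, x, rfl, hx⟩, ?_⟩
    rw [← hcode]
    show code (rp (E.symm (E _))) = _
    rw [E.symm_apply_apply, hrp1]
  -- finite sets
  have hY : ∀ j, ∃ Y : Set M, Y.Finite ∧ (∀ i, c j i ∈ Y) ∧ ∀ x : Fin p → M,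
      ∃ x', (∀ i, x' i ∈ Y) ∧ relOver L (c j) x x' := by
    intro j
    let r : (Fin p → M) → Fin Q2 := fun x => code2 (Fin.append x (c j))
    have hr : ∀ q : Set.range r, ∃ x, r x = q := fun q => q.2
    choose R hR using hr
    refine ⟨Set.range (c j) ∪ ⋃ q, Set.range (R q), (Set.finite_range _).union
      (Set.finite_iUnion fun q => Set.finite_range _), fun i => Or.inl ⟨i, rfl⟩, fun x => ?_⟩
    refine ⟨R ⟨r x, x, rfl⟩, fun i => Or.inr (Set.mem_iUnion.2 ⟨_, i, rfl⟩), ?_⟩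
    exact (hcode2 _ _).1 (hR ⟨r x, x, rfl⟩).symm
  choose Y hYf hYc hYr using hY
  choose rep hrepY hrep using hYr
  have hQ : Nonempty (Fin Q) := ⟨code fun _ => m₀⟩
  let F : Fin k → Set (Fin p → M) := fun j => {x | ∀ i, x i ∈ Y j}
  have hF : ∀ j, (F j).Finite := fun j => Set.Finite.pi' fun _ => hYf j
  obtain ⟨Es, hEs, hRA⟩ := RA.prod (Fin Q) (fun j => fixMaps L (c j)) (fun j => relOver L (c j))
    (fun j => RA.over hord hhom hram (c j)) F hF
  let X : Set M := {m₀} ∪ (⋃ j, Set.range (c j)) ∪ ⋃ j, ⋃ x ∈ Es j, Set.range x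
  have hX : X.Finite := ((Set.finite_singleton _).union
    (Set.finite_iUnion fun j => Set.finite_range _)).union
    (Set.finite_iUnion fun j => (hEs j).biUnion fun x _ => Set.finite_range x)
  have hcX : ∀ j i, c j i ∈ X := fun j i => Or.inl (Or.inr (Set.mem_iUnion.2 ⟨j, i, rfl⟩))
  have hEX : ∀ j, ∀ x ∈ Es j, ∀ i, x i ∈ X := fun j x hx i =>
    Or.inr (Set.mem_iUnion.2 ⟨j, Set.mem_biUnion hx ⟨i, rfl⟩⟩)
  obtain ⟨f, hf, hf0⟩ := exists_poly (L := sigOf l) (fun x => φ₀.2.Realize x)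
    (fun ⟨ψ, h1, h2⟩ => h ⟨ψ, h1, h2⟩) (fun j => c j ∘ Fin.castLE hp₀) (by
      intro x hx
      let x' : Fin p → M := fun i => if h : i.1 < φ₀.1 then x ⟨i.1, h⟩ else m₀
      have hx' : x' ∘ Fin.castLE hp₀ = x := by
        funext i
        simp [x']
      obtain ⟨j, g, hg⟩ := hcov x' (fun _ => by rw [hx']; exact hx)
      refine ⟨j, g, ?_, ?_⟩
      · intro n r y hy
        exact hinv (l.get r.1) _ _ ⟨g, fun _ => rfl⟩ hy
      · rw [← hx']
        funext i
        exact hg _) X hX ⟨m₀, Or.inl (Or.inl rfl)⟩ (fun j i => hcX j _)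
  obtain ⟨g, hgG, hgE, hg⟩ := hRA (fun x => code (fun i => f (fun j => x j i)))
  choose γ hγ1 hγ2 using hgG
  let ξ : (Fin k → Fin p → M) → (Fin p → M) := fun x i => f (fun j => g j (rep j (x j)) i)
  refine ⟨k, hk, c, ξ, hcS, ?_, ?_, ?_, ?_⟩
  · intro x x' hxx
    rw [← hcode]
    refine hg (fun j => rep j (x j)) (fun j => rep j (x' j)) (fun j => hrepY _ _)
      (fun j => hrepY _ _) (fun j => ?_)
    exact ((hrep j (x j)).symm.trans (hxx j)).trans (hrep j (x' j))
  · intro x π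
    rw [← hcode]
    have := hg (fun j => rep j (x j ∘ π)) (fun j => rep j (x j) ∘ π) (fun j => hrepY _ _)
      (fun j i => hrepY _ _ _) (fun j => (hrep j (x j ∘ π)).symm.trans ((hrep j (x j)).comp π))
    refine this.trans (congrArg code ?_)
    funext i
    simp only [ξ, hγ2, Function.comp]
  · intro φ hφ x hx hle
    obtain ⟨i, rfl⟩ := List.get_of_mem hφ
    have := hf _ (⟨i, rfl⟩ : (sigOf l).Relations (l.get i).1)
      (fun j => g j (rep j (x j)) ∘ Fin.castLE hle) (fun j i => hEX j _ (hgE j _ (hrepY _ _)) _)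
      (fun j => ?_)
    · exact this
    · have h1 : SO L (x j) (g j (rep j (x j))) := by
        have h2 := SO.comp (hrep j (x j)) (Fin.castAdd p)
        have e : ∀ x : Fin p → M, Fin.append x (c j) ∘ Fin.castAdd p = x := fun x => by
          funext i
          simp only [Function.comp, Fin.append_left]
        rw [e, e] at h2
        refine h2.trans ⟨γ j, fun i => ?_⟩
        rw [hγ2]; rfl
      exact hinv.sat h1 _ (hx j) hle
  · intro hs
    apply hf0
    have h1 : SO L (ξ c) (fun i => f (fun j => c j i)) := by
      rw [← hcode]
      have := hg (fun j => rep j (c j)) c (fun j => hrepY _ _)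
        (fun j i => hYc _ _) (fun j => (hrep j (c j)).symm)
      refine this.trans (congrArg code ?_)
      funext i
      simp only [hγ2, Function.comp, hγ1]
    exact hinv.sat h1 _ hs hp₀

theorem not_pp_of_crit [L.IsRelational] [Nonempty M] (hhom : L.IsUltrahomogeneous M)
    (hinv : Inv L L' M) {b : ℕ} (hb : 3 ≤ b)
    (har : ∀ a (_ : L.Relations a), 2 * a ≤ b) (hreal : RealB L M b) {p Q : ℕ} (hbp : b ≤ p)
    (φ₀ : FormulaCode L') (l : List (FormulaCode L'))
    (hp₀ : φ₀.1 ≤ p) (hp : ∀ φ ∈ l, φ.1 ≤ p)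
    (h : Crit L M p Q φ₀ l) : ¬ ExprYesPP M φ₀ l := by
  classical
  let _ := structOf M l
  obtain ⟨m₀⟩ := ‹Nonempty M›
  obtain ⟨k, -, c, ξ, hcS, -, hπ, hpres, hno⟩ := h
  rintro ⟨ψ, hψ, hψr⟩
  obtain ⟨X, hX, hloc⟩ := pp_local (L := sigOf l) (fun j => c j ∘ Fin.castLE hp₀) ψ hψ
    (fun _ => default) (fun j => (hψr _).1 (hcS j hp₀))
  let Z : Set M := {m₀} ∪ X ∪ ⋃ j, Set.range (c j)
  have hZ : Z.Finite := ((Set.finite_singleton _).union hX).union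
    (Set.finite_iUnion fun j => Set.finite_range _)
  have hXZ : ∀ x ∈ X, x ∈ Z := fun x hx => Or.inl (Or.inr hx)
  have hcZ : ∀ j i, c j i ∈ Z := fun j i => Or.inr (Set.mem_iUnion.2 ⟨j, i, rfl⟩)
  have : Finite Z := hZ
  let z₀ : Z := ⟨m₀, Or.inl (Or.inl rfl)⟩
  have : Nonempty (Fin b) := ⟨⟨0, by omega⟩⟩
  obtain ⟨ι, e, he⟩ := exists_retract (b := p) (W := Fin b) (by simpa using hbp)
  obtain ⟨a, ha⟩ := hreal (Fin k → Z) (fun s => ξ (fun j i => s (e i) j) ∘ ι) (by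
    intro s π
    have h1 := (hπ (fun j i => (s (e i) j : M)) (ι ∘ π ∘ e)).comp ι
    have e1 : (fun j => (fun i => (s (e i) j : M)) ∘ (ι ∘ π ∘ e)) =
        fun j i => ((s ∘ π) (e i) j : M) := by
      funext j i
      simp [he]
    have e2 : (ξ (fun j i => (s (e i) j : M)) ∘ (ι ∘ π ∘ e)) ∘ ι =
        (ξ (fun j i => (s (e i) j : M)) ∘ ι) ∘ π := by
      funext i
      simp [he]
    rw [e1, e2] at h1
    exact h1.symm)
  have key : ∀ z : Fin p → (Fin k → Z), SO L (a ∘ z) (ξ (fun j i => (z i j : M))) := by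
    intro z
    refine SO.of_local hhom hb har _ _ fun s => ?_
    refine (ha (z ∘ s)).trans ?_
    have h1 := (hπ (fun j i => (z i j : M)) (s ∘ e)).comp ι
    have e2 : (ξ (fun j i => (z i j : M)) ∘ s ∘ e) ∘ ι = ξ (fun j i => (z i j : M)) ∘ s := by
      funext i
      simp [he]
    rw [e2] at h1
    exact h1
  let f : (Fin k → M) → M := fun z => if h : ∀ j, z j ∈ Z then a (fun j => ⟨z j, h j⟩) else m₀
  have hfpres : PresOn (sigOf l) X f := by
    rintro n ⟨i, rfl⟩ rows hm hr
    let φ := l.get i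
    have hle : φ.1 ≤ p := hp φ (List.get_mem _ _)
    let z : Fin p → (Fin k → Z) := fun i' j =>
      if h : i'.1 < φ.1 then ⟨rows j ⟨i'.1, h⟩, hXZ _ (hm _ _)⟩ else z₀
    have h1 : Sat (ξ (fun j i => (z i j : M))) φ := by
      refine hpres φ (List.get_mem _ _) _ (fun j hle' => ?_)
      have : (fun i => (z i j : M)) ∘ Fin.castLE hle' = rows j := by
        funext i'
        simp [z]
      rw [this]
      exact hr j
    have h2 := hinv.sat (key z).symm φ h1 hle
    have h3 : (a ∘ z) ∘ Fin.castLE hle = fun i => f (fun j => rows j i) := by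
      funext i'
      have : ∀ j, rows j i' ∈ Z := fun j => hXZ _ (hm _ _)
      simp only [f, dif_pos this, Function.comp]
      congr 1
      funext j
      simp [z]
    rw [h3] at h2
    exact h2
  have h1 := (hψr _).2 (show ψ.Realize (fun i => f (fun j => c j (Fin.castLE hp₀ i))) by
    have := hloc f hfpres
    rw [Subsingleton.elim (fun i => f fun j => (default : Fin 0 → M) i) default] at this
    exact this)
  apply hno
  have h2 := key (fun i j => ⟨c j i, hcZ j i⟩)
  refine hinv.sat h2 φ₀ (fun hle => ?_)
  convert h1 using 1
  funext i
  have : ∀ j, c j (Fin.castLE hp₀ i) ∈ Z := fun j => hcZ _ _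
  simp only [f, dif_pos this, Function.comp]

end Crit
end PaperDef

namespace PaperDef

/-- The `i`-th digit of `n` in base `B`. -/
def dig (B n i : ℕ) : ℕ := n / B ^ i % B

theorem dig_lt {B : ℕ} (hB : 0 < B) (n i : ℕ) : dig B n i < B := Nat.mod_lt _ hB

/-- The number with given digits. -/
def cd {B K : ℕ} (s : Fin K → Fin B) : ℕ := (finFunctionFinEquiv s : Fin (B ^ K))

theorem cd_lt {B K : ℕ} (s : Fin K → Fin B) : cd s < B ^ K := (finFunctionFinEquiv s).2

theorem dig_cd {B K : ℕ} (s : Fin K → Fin B) (i : Fin K) : dig B (cd s) i = s i := by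
  have h := congrFun (finFunctionFinEquiv.symm_apply_apply s) i
  have h2 := congrArg Fin.val h
  rw [← h2]
  rfl

/-- The digits of `n`, as a map between finite sets. -/
def dmap (B n K : ℕ) [NeZero B] : Fin K → Fin B := fun i => ⟨dig B n i, dig_lt (NeZero.pos B) n i⟩

theorem dmap_cd {B K : ℕ} [NeZero B] (s : Fin K → Fin B) : dmap B (cd s) K = s :=
  funext fun i => Fin.ext (dig_cd s i)

theorem cd_dmap {B K n : ℕ} [NeZero B] (h : n < B ^ K) : cd (dmap B n K) = n := by
  have := congrArg Fin.val (finFunctionFinEquiv.apply_symm_apply (⟨n, h⟩ : Fin (B ^ K)))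
  exact this

theorem exists_cd {B K n : ℕ} [NeZero B] (h : n < B ^ K) : ∃ s : Fin K → Fin B, cd s = n :=
  ⟨_, cd_dmap h⟩

/-- The type `D'` is obtained from `D` by substitution along `ρ`. -/
def Re (b q N N' D ρ D' : ℕ) : Prop :=
  ∀ s < N' ^ b, ∀ t < N ^ b, (∀ i < b, dig N t i = dig N ρ (dig N' s i)) → dig q D' s = dig q D t

/-- The number `D` codes a realizable type of `N`-tuples. -/
def Valid (b q : ℕ) (Tab : ℕ → ℕ → ℕ → Prop) (N D : ℕ) : Prop :=
  ∀ s < N ^ b, ∀ t < N ^ b, ∀ π < b ^ b, (∀ i < b, dig N t i = dig N s (dig b π i)) →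
    Tab (dig q D s) π (dig q D t)

/-- The types coded by `w` extend the types coded by `r`. -/
def Good (b q : ℕ) (Tab : ℕ → ℕ → ℕ → Prop) (p k r w : ℕ) : Prop :=
  ∀ j < k, Valid b q Tab (p + p) (dig (q ^ (p + p) ^ b) w j) ∧
    ∀ ρ < (p + p) ^ p, (∀ i < p, dig (p + p) ρ i = p + i) →
      Re b q (p + p) p (dig (q ^ (p + p) ^ b) w j) ρ (dig (q ^ p ^ b) r j)

/-- The arithmetical form of the criterion. -/
def Phi (b q : ℕ) (Tab ev : ℕ → ℕ → ℕ → Prop) (p n₀ : ℕ) (ls : List ℕ) : Prop :=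
  ∃ k < q ^ p ^ b + 1, ∃ r < (q ^ p ^ b) ^ k, ∃ ξ < (q ^ p ^ b) ^ (q ^ (p + p) ^ b) ^ k,
    (∀ j < k, Valid b q Tab p (dig (q ^ p ^ b) r j) ∧ ev p (dig (q ^ p ^ b) r j) n₀) ∧
    ∀ w < (q ^ (p + p) ^ b) ^ k, Good b q Tab p k r w →
      Valid b q Tab p (dig (q ^ p ^ b) ξ w) ∧
      (∀ w' < (q ^ (p + p) ^ b) ^ k, Good b q Tab p k r w' → ∀ π < p ^ p,
        ∀ ρ < (p + p) ^ (p + p),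
          (∀ i < p, dig (p + p) ρ i = dig p π i ∧ dig (p + p) ρ (p + i) = p + i) →
          (∀ j < k, Re b q (p + p) (p + p) (dig (q ^ (p + p) ^ b) w j) ρ
            (dig (q ^ (p + p) ^ b) w' j)) →
          Re b q p p (dig (q ^ p ^ b) ξ w) π (dig (q ^ p ^ b) ξ w')) ∧
      (∀ n ∈ ls, (∀ j < k, ev (p + p) (dig (q ^ (p + p) ^ b) w j) n) →
        ev p (dig (q ^ p ^ b) ξ w) n) ∧
      ((∀ j < k, ∀ ρ < (p + p) ^ (p + p),
          (∀ i < p, dig (p + p) ρ i = i ∧ dig (p + p) ρ (p + i) = i) →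
          Re b q (p + p) (p + p) (dig (q ^ (p + p) ^ b) w j) ρ (dig (q ^ (p + p) ^ b) w j)) →
        ¬ ev p (dig (q ^ p ^ b) ξ w) n₀)

section Coded

variable {L L' : Language} {M : Type} [L.Structure M] [L'.Structure M]
variable {b q : ℕ} (tp : (Fin b → M) → ℕ)

/-- `D` codes the type of `x`. -/
def IsDg (q : ℕ) {b : ℕ} (tp : (Fin b → M) → ℕ) {N : ℕ} (D : ℕ) (x : Fin N → M) : Prop :=
  ∀ s : Fin b → Fin N, dig q D (cd s) = tp (x ∘ s)

/-- The code of the type of `x`. -/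
noncomputable def codeT {b q : ℕ} (tp : (Fin b → M) → ℕ) (htq : ∀ x, tp x < q) {N : ℕ}
    [NeZero N] (x : Fin N → M) : ℕ :=
  cd (B := q) (K := N ^ b) (fun σ => ⟨tp (x ∘ dmap N σ b), htq _⟩)

theorem codeT_lt (htq : ∀ x, tp x < q) {N : ℕ} [NeZero N] (x : Fin N → M) :
    codeT tp htq x < q ^ N ^ b := cd_lt _

theorem isDg_codeT (htq : ∀ x, tp x < q) {N : ℕ} [NeZero N] (x : Fin N → M) :
    IsDg q tp (codeT tp htq x) x := by
  intro s
  have := dig_cd (B := q) (K := N ^ b) (fun σ => ⟨tp (x ∘ dmap N σ b), htq _⟩) ⟨cd s, cd_lt s⟩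
  refine this.trans ?_
  simp only [dmap_cd]

/-- The table of restrictions of types. -/
def TabOf {b : ℕ} [NeZero b] (tp : (Fin b → M) → ℕ) (τ π τ' : ℕ) : Prop :=
  ∃ y : Fin b → M, tp y = τ ∧ tp (y ∘ dmap b π b) = τ'

variable {tp}

theorem IsDg.so [L.IsRelational] (hhom : L.IsUltrahomogeneous M) (hb : 3 ≤ b)
    (har : ∀ a (_ : L.Relations a), 2 * a ≤ b) (htp : ∀ x y, tp x = tp y ↔ SO L x y)
    {N D : ℕ} {x y : Fin N → M} (h : IsDg q tp D x) (h' : IsDg q tp D y) : SO L x y :=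
  SO.of_local hhom hb har x y fun s => (htp _ _).1 ((h s).symm.trans (h' s))

theorem IsDg.of_so (htp : ∀ x y, tp x = tp y ↔ SO L x y)
    {N D : ℕ} {x y : Fin N → M} (h : IsDg q tp D x) (h' : SO L x y) : IsDg q tp D y :=
  fun s => (h s).trans ((htp _ _).2 (h'.comp s))

theorem IsDg.re_iff [NeZero b] {N N' : ℕ} [NeZero N] [NeZero N'] {D ρ D' : ℕ} {x : Fin N → M}
    (h : IsDg q tp D x) (ρ' : Fin N' → Fin N) (hρ : ∀ i : Fin N', dig N ρ i = ρ' i) :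
    Re b q N N' D ρ D' ↔ IsDg q tp D' (x ∘ ρ') := by
  constructor
  · intro hre s
    have := hre (cd s) (cd_lt s) (cd (ρ' ∘ s)) (cd_lt _) (fun i hi => by
      have h1 := dig_cd s ⟨i, hi⟩
      have h2 := dig_cd (ρ' ∘ s) ⟨i, hi⟩
      simp only at h1 h2
      rw [h1, h2, hρ]
      rfl)
    rw [this, h]
    rfl
  · intro hd s hs t ht hst
    obtain ⟨s, rfl⟩ := exists_cd hs
    obtain ⟨t, rfl⟩ := exists_cd ht
    have : t = ρ' ∘ s := by
      funext i
      apply Fin.ext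
      have := hst i i.2
      rw [dig_cd, dig_cd, hρ] at this
      exact this
    rw [hd, h, this]
    rfl

theorem valid_iff [NeZero b] [L.IsRelational] (hreal : RealB L M b) (htp : ∀ x y, tp x = tp y ↔ SO L x y)
    {N D : ℕ} [NeZero N] : Valid b q (TabOf tp) N D ↔ ∃ x : Fin N → M, IsDg q tp D x := by
  constructor
  · intro hv
    have h1 : ∀ (s : Fin b → Fin N) (π : Fin b → Fin b), ∃ y : Fin b → M,
        tp y = dig q D (cd s) ∧ tp (y ∘ π) = dig q D (cd (s ∘ π)) := by
      intro s π
      obtain ⟨y, hy⟩ := hv (cd s) (cd_lt s) (cd (s ∘ π)) (cd_lt _) (cd π) (cd_lt _) (fun i hi => by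
        have h1 := dig_cd π ⟨i, hi⟩
        have h2 := dig_cd (s ∘ π) ⟨i, hi⟩
        simp only at h1 h2
        rw [h1, h2, dig_cd]
        rfl)
      rw [dmap_cd] at hy
      exact ⟨y, hy⟩
    have h2 : ∀ s : Fin b → Fin N, ∃ y : Fin b → M, tp y = dig q D (cd s) := fun s =>
      (h1 s id).imp fun y hy => hy.1
    choose y hy using h2
    obtain ⟨x, hx⟩ := hreal (Fin N) y (by
      intro s π
      obtain ⟨z, hz1, hz2⟩ := h1 s π
      have e1 : SO L (y s) z := (htp _ _).1 ((hy s).trans hz1.symm)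
      exact (e1.comp π).trans ((htp _ _).1 (hz2.trans (hy _).symm)))
    exact ⟨x, fun s => (hy s).symm.trans ((htp _ _).2 (hx s).symm)⟩
  · rintro ⟨x, hx⟩ s hs t ht π hπ hst
    obtain ⟨s, rfl⟩ := exists_cd hs
    obtain ⟨t, rfl⟩ := exists_cd ht
    refine ⟨x ∘ s, (hx s).symm, ?_⟩
    rw [hx]
    congr 1
    have : t = s ∘ dmap b π b := by
      funext i
      apply Fin.ext
      have := hst i i.2
      rw [dig_cd] at this
      rw [this]
      exact dig_cd s (dmap b π b i)
    rw [this]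
    rfl

theorem append_natAdd {p : ℕ} (x c : Fin p → M) : Fin.append x c ∘ Fin.natAdd p = c := by
  funext i
  simp only [Function.comp, Fin.append_right]

theorem append_castAdd {p : ℕ} (x c : Fin p → M) : Fin.append x c ∘ Fin.castAdd p = x := by
  funext i
  simp only [Function.comp, Fin.append_left]

theorem append_eta {p : ℕ} (u : Fin (p + p) → M) :
    Fin.append (u ∘ Fin.castAdd p) (u ∘ Fin.natAdd p) = u := by
  funext i
  refine Fin.addCases (fun i => ?_) (fun i => ?_) i <;>
    simp only [Function.comp, Fin.append_left, Fin.append_right]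

theorem good_iff [NeZero b] [L.IsRelational] (hhom : L.IsUltrahomogeneous M) (hb : 3 ≤ b)
    (har : ∀ a (_ : L.Relations a), 2 * a ≤ b) (hreal : RealB L M b)
    (htp : ∀ x y, tp x = tp y ↔ SO L x y) {p k r w : ℕ} [NeZero p] (c : Fin k → Fin p → M)
    (hc : ∀ j : Fin k, IsDg q tp (dig (q ^ p ^ b) r j) (c j)) :
    Good b q (TabOf tp) p k r w ↔ ∀ j : Fin k, ∃ x : Fin p → M,
      IsDg q tp (dig (q ^ (p + p) ^ b) w j) (Fin.append x (c j)) := by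
  have : NeZero (p + p) := ⟨by have := NeZero.ne p; omega⟩
  have key : ∀ {u : Fin (p + p) → M} {D D' ρ : ℕ}, IsDg q tp D u →
      (∀ i < p, dig (p + p) ρ i = p + i) →
      (Re b q (p + p) p D ρ D' ↔ IsDg q tp D' (u ∘ Fin.natAdd p)) := by
    intro u D D' ρ hD hρ
    exact hD.re_iff (Fin.natAdd p) (fun i => hρ i i.2)
  constructor
  · intro h j
    obtain ⟨hv, hr⟩ := h j j.2
    obtain ⟨u, hu⟩ := (valid_iff hreal htp).1 hv
    have h1 := hr (cd (B := p + p) (K := p) (Fin.natAdd p)) (cd_lt _)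
      (fun i hi => dig_cd (B := p + p) (K := p) (Fin.natAdd p) ⟨i, hi⟩)
    rw [key hu (fun i hi => dig_cd (B := p + p) (K := p) (Fin.natAdd p) ⟨i, hi⟩)] at h1
    obtain ⟨g, hg⟩ := h1.so hhom hb har htp (hc j)
    refine ⟨g ∘ u ∘ Fin.castAdd p, hu.of_so htp ⟨g, fun i => ?_⟩⟩
    have e : c j = g ∘ u ∘ Fin.natAdd p := funext fun i => (hg i).symm
    rw [e, ← append_comp, append_eta]
    rfl
  · intro h j hj
    obtain ⟨x, hx⟩ := h ⟨j, hj⟩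
    refine ⟨(valid_iff hreal htp).2 ⟨_, hx⟩, fun ρ _ hρ => ?_⟩
    rw [key hx hρ, append_natAdd]
    exact hc ⟨j, hj⟩

theorem sat_append {p : ℕ} (x c : Fin p → M) (φ : FormulaCode L') (hφ : φ.1 ≤ p) :
    Sat (Fin.append x c) φ ↔ Sat x φ := by
  have h : ∀ h1 : φ.1 ≤ p + p, Fin.append x c ∘ Fin.castLE h1 = x ∘ Fin.castLE hφ := by
    intro h1
    funext i
    have := Fin.append_left x c (Fin.castLE hφ i)
    exact this
  constructor
  · intro hs _
    have := hs (by omega)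
    rwa [h] at this
  · intro hs h1
    rw [h]
    exact hs hφ

theorem crit_iff_phi [NeZero b] [L.IsRelational] (hhom : L.IsUltrahomogeneous M) (hb : 3 ≤ b)
    (har : ∀ a (_ : L.Relations a), 2 * a ≤ b) (hreal : RealB L M b)
    (htq : ∀ x, tp x < q) (htp : ∀ x y, tp x = tp y ↔ SO L x y)
    {p : ℕ} (hp : 0 < p) (ev : ℕ → ℕ → ℕ → Prop)
    (φ₀ : FormulaCode L') (l : List (FormulaCode L')) (enc : FormulaCode L' → ℕ)
    (hev : ∀ φ ∈ φ₀ :: l, ∀ (N D : ℕ) (x : Fin N → M), p ≤ N → IsDg q tp D x →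
      (ev N D (enc φ) ↔ Sat x φ))
    (hp₀ : φ₀.1 ≤ p) (hpl : ∀ φ ∈ l, φ.1 ≤ p) (hinv : Inv L L' M) [Nonempty M] :
    Crit L M p (q ^ p ^ b) φ₀ l ↔ Phi b q (TabOf tp) ev p (enc φ₀) (l.map enc) := by
  classical
  have : NeZero p := ⟨by omega⟩
  have : NeZero (p + p) := ⟨by omega⟩
  have hq : 0 < q := Nat.zero_lt_of_lt (htq fun _ => Classical.arbitrary M)
  have : NeZero (q ^ p ^ b) := ⟨(pow_pos hq _).ne'⟩
  have : NeZero (q ^ (p + p) ^ b) := ⟨(pow_pos hq _).ne'⟩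
  -- maps used
  have hπh : ∀ (π : Fin p → Fin p) (x c : Fin p → M),
      Fin.append x c ∘ Fin.append (Fin.castAdd p ∘ π) (Fin.natAdd p) = Fin.append (x ∘ π) c := by
    intro π x c
    rw [append_comp]
    congr 1
    · funext i
      simp only [Function.comp, Fin.append_left]
    · funext i
      simp only [Function.comp, Fin.append_right]
  have hρ1 : ∀ {ρ π : ℕ}, (∀ i < p, dig (p + p) ρ i = dig p π i ∧ dig (p + p) ρ (p + i) = p + i) →
      ∀ i : Fin (p + p), dig (p + p) ρ i =
        (Fin.append (Fin.castAdd p ∘ dmap p π p) (Fin.natAdd p) i : Fin (p + p)) := by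
    intro ρ π h i
    refine Fin.addCases (fun i => ?_) (fun i => ?_) i
    · rw [Fin.append_left]
      exact (h i i.2).1
    · rw [Fin.append_right]
      exact (h i i.2).2
  have hρ2 : ∀ {ρ : ℕ}, (∀ i < p, dig (p + p) ρ i = i ∧ dig (p + p) ρ (p + i) = i) →
      ∀ i : Fin (p + p), dig (p + p) ρ i =
        (Fin.append (Fin.castAdd p) (Fin.castAdd p) i : Fin (p + p)) := by
    intro ρ h i
    refine Fin.addCases (fun i => ?_) (fun i => ?_) i
    · rw [Fin.append_left]
      exact (h i i.2).1
    · rw [Fin.append_right]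
      exact (h i i.2).2
  have hdiag : ∀ (x c : Fin p → M),
      Fin.append x c ∘ Fin.append (Fin.castAdd p) (Fin.castAdd p) = Fin.append x x := by
    intro x c
    rw [append_comp, append_castAdd]
  constructor
  · rintro ⟨k, hk, c, ξ, hcS, h2, h2', h3, h4⟩
    let r : ℕ := cd (B := q ^ p ^ b) (fun j : Fin k => ⟨codeT tp htq (c j), codeT_lt tp htq _⟩)
    have hr : ∀ j : Fin k, IsDg q tp (dig (q ^ p ^ b) r j) (c j) := by
      intro j
      rw [dig_cd]
      exact isDg_codeT tp htq _
    have hgood := fun w => good_iff (w := w) hhom hb har hreal htp c hr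
    let X : (w : ℕ) → Good b q (TabOf tp) p k r w → Fin k → Fin p → M :=
      fun w hw j => ((hgood w).1 hw j).choose
    have hX : ∀ w hw (j : Fin k),
        IsDg q tp (dig (q ^ (p + p) ^ b) w j) (Fin.append (X w hw j) (c j)) :=
      fun w hw j => ((hgood w).1 hw j).choose_spec
    let Ξ : Fin ((q ^ (p + p) ^ b) ^ k) → Fin (q ^ p ^ b) := fun w =>
      if hw : Good b q (TabOf tp) p k r w then ⟨codeT tp htq (ξ (X w hw)), codeT_lt tp htq _⟩
      else ⟨0, pow_pos hq _⟩
    have hΞ : ∀ w < (q ^ (p + p) ^ b) ^ k, ∀ hw, IsDg q tp (dig (q ^ p ^ b) (cd Ξ) w) (ξ (X w hw)) := by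
      intro w hlt hw
      have := dig_cd Ξ ⟨w, hlt⟩
      simp only at this
      rw [this]
      simp only [Ξ, dif_pos hw]
      exact isDg_codeT tp htq _
    refine ⟨k, by omega, r, cd_lt _, cd Ξ, cd_lt _, fun j hj => ?_, fun w hw hgw => ?_⟩
    · have h1 := hr ⟨j, hj⟩
      refine ⟨(valid_iff hreal htp).2 ⟨_, h1⟩, ?_⟩
      exact (hev φ₀ (by simp) p _ _ le_rfl h1).2 (hcS _)
    · have hD := hΞ w hw hgw
      refine ⟨(valid_iff hreal htp).2 ⟨_, hD⟩, ?_, ?_, ?_⟩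
      · intro w' hw' hgw' π hπ ρ hρ hρπ hre
        have hD' := hΞ w' hw' hgw'
        rw [hD.re_iff (dmap p π p) (fun i => rfl)]
        refine hD'.of_so htp ?_
        refine SO.trans ?_ (h2' _ _)
        refine h2 _ _ fun j => ?_
        have e1 := (hX w hgw j).re_iff (D' := dig (q ^ (p + p) ^ b) w' j) _ (hρ1 hρπ)
        rw [hπh] at e1
        exact (hX w' hgw' j).so hhom hb har htp (e1.1 (hre j j.2))
      · intro n hn hs
        obtain ⟨φ, hφ, rfl⟩ := List.mem_map.1 hn
        rw [hev φ (by simp [hφ]) _ _ _ le_rfl hD]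
        refine h3 φ hφ _ fun j => ?_
        have := (hev φ (by simp [hφ]) _ _ _ (by omega) (hX w hgw j)).1 (hs j j.2)
        exact (sat_append _ _ φ (hpl φ hφ)).1 this
      · intro hs
        rw [hev φ₀ (by simp) _ _ _ le_rfl hD]
        have : X w hgw = c := by
          funext j
          have e0 := hs j j.2 (cd (B := p + p) (K := p + p)
            (Fin.append (Fin.castAdd p) (Fin.castAdd p))) (cd_lt _) (fun i hi => by
              have a1 := dig_cd (B := p + p) (K := p + p)
                (Fin.append (Fin.castAdd p) (Fin.castAdd p)) (Fin.castAdd p ⟨i, hi⟩)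
              have a2 := dig_cd (B := p + p) (K := p + p)
                (Fin.append (Fin.castAdd p) (Fin.castAdd p)) (Fin.natAdd p ⟨i, hi⟩)
              rw [Fin.append_left] at a1
              rw [Fin.append_right] at a2
              exact ⟨a1, a2⟩)
          rw [(hX w hgw j).re_iff _ (dig_cd _), hdiag] at e0
          have e1 := (hX w hgw j).so hhom hb har htp e0
          funext i
          have e2 := e1.eq_iff (Fin.castAdd p i) (Fin.natAdd p i)
          rw [Fin.append_left, Fin.append_left, Fin.append_right, Fin.append_right] at e2
          exact e2.2 rfl
        rw [this]
        exact h4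
  · rintro ⟨k, hk, r, hr, Ξ, hΞ, hA, hB⟩
    have hc : ∀ j : Fin k, ∃ c : Fin p → M, IsDg q tp (dig (q ^ p ^ b) r j) c := fun j =>
      (valid_iff hreal htp).1 (hA j j.2).1
    choose c hc using hc
    have hgood := fun w => good_iff (w := w) hhom hb har hreal htp c hc
    let W : (Fin k → Fin p → M) → ℕ := fun x => cd (B := q ^ (p + p) ^ b)
      (fun j : Fin k => ⟨codeT tp htq (Fin.append (x j) (c j)), codeT_lt tp htq _⟩)
    have hWlt : ∀ x, W x < (q ^ (p + p) ^ b) ^ k := fun x => cd_lt _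
    have hW : ∀ x (j : Fin k), IsDg q tp (dig (q ^ (p + p) ^ b) (W x) j)
        (Fin.append (x j) (c j)) := by
      intro x j
      rw [dig_cd]
      exact isDg_codeT tp htq _
    have hWg : ∀ x, Good b q (TabOf tp) p k r (W x) := fun x => (hgood _).2 fun j => ⟨_, hW x j⟩
    let ξ : (Fin k → Fin p → M) → Fin p → M := fun x =>
      ((valid_iff hreal htp).1 (hB (W x) (hWlt x) (hWg x)).1).choose
    have hξ : ∀ x, IsDg q tp (dig (q ^ p ^ b) Ξ (W x)) (ξ x) := fun x =>
      ((valid_iff hreal htp).1 (hB (W x) (hWlt x) (hWg x)).1).choose_spec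
    refine ⟨k, by omega, c, ξ, fun j => ?_, ?_, ?_, ?_, ?_⟩
    · exact (hev φ₀ (by simp) p _ _ le_rfl (hc j)).1 (hA j j.2).2
    · intro x x' hxx
      have : W x = W x' := by
        simp only [W]
        congr 1
        funext j
        apply Fin.ext
        simp only [codeT]
        congr 1
        funext σ
        apply Fin.ext
        exact (htp _ _).2 (SO.comp (hxx j) _)
      have e := hξ x'
      rw [← this] at e
      exact (hξ x).so hhom hb har htp e
    · intro x π
      have := (hB (W x) (hWlt x) (hWg x)).2.1 (W (fun j => x j ∘ π)) (hWlt _) (hWg _) (cd π)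
        (cd_lt _) (cd (B := p + p) (K := p + p)
          (Fin.append (Fin.castAdd p ∘ π) (Fin.natAdd p))) (cd_lt _)
          (fun i hi => by
            have a1 := dig_cd (B := p + p) (K := p + p)
              (Fin.append (Fin.castAdd p ∘ π) (Fin.natAdd p)) (Fin.castAdd p ⟨i, hi⟩)
            have a2 := dig_cd (B := p + p) (K := p + p)
              (Fin.append (Fin.castAdd p ∘ π) (Fin.natAdd p)) (Fin.natAdd p ⟨i, hi⟩)
            have a3 := dig_cd π ⟨i, hi⟩
            rw [Fin.append_left] at a1
            rw [Fin.append_right] at a2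
            exact ⟨a1.trans a3.symm, a2⟩)
          (fun j hj => by
            rw [(hW x ⟨j, hj⟩).re_iff _ (dig_cd _), hπh]
            exact hW (fun j => x j ∘ π) ⟨j, hj⟩)
      rw [(hξ x).re_iff π (dig_cd π)] at this
      exact (hξ _).so hhom hb har htp this
    · intro φ hφ x hx
      rw [← hev φ (by simp [hφ]) _ _ _ le_rfl (hξ x)]
      refine (hB (W x) (hWlt x) (hWg x)).2.2.1 _ (List.mem_map_of_mem hφ) fun j hj => ?_
      rw [hev φ (by simp [hφ]) _ _ _ (by omega) (hW x ⟨j, hj⟩)]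
      exact (sat_append _ _ φ (hpl φ hφ)).2 (hx _)
    · rw [← hev φ₀ (by simp) _ _ _ le_rfl (hξ c)]
      refine (hB (W c) (hWlt c) (hWg c)).2.2.2 fun j hj ρ hρ hρi => ?_
      rw [(hW c ⟨j, hj⟩).re_iff _ (hρ2 hρi), hdiag]
      exact hW c ⟨j, hj⟩

end Coded
end PaperDef

namespace PaperDef

section Eval

/-- Decoding of a variable from the code of a term. -/
def tv (h : ℕ) : ℕ := (Nat.unpair ((Nat.unpair (h / 2)).2 - 1)).1 / 4

/-- Evaluation of an equality. -/
def EqA (b q : ℕ) (eqT : ℕ → Prop) (N D h : ℕ) (t : List ℕ) : Prop :=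
  ∃ s < N ^ b, dig N s 0 = tv h ∧ dig N s 1 = tv (t.getI 0) ∧ eqT (dig q D s)

/-- Evaluation of a relation. -/
def RelA (b q : ℕ) (relT : ℕ → ℕ → Prop) (N D h : ℕ) (t : List ℕ) : Prop :=
  ∃ s < N ^ b, (∀ i < (Nat.unpair (h / 4)).1, dig N s i = tv (t.getI (1 + i))) ∧
    relT (h / 4) (dig q D s)

open Classical in
/-- One step of the evaluation; produces the truth value and the length. -/
noncomputable def evStep (b q : ℕ) (eqT : ℕ → Prop) (relT : ℕ → ℕ → Prop) (N D h : ℕ) (t : List ℕ)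
    (P : List (Bool × ℕ)) : Bool × ℕ :=
  if h % 2 = 0 then (decide (EqA b q eqT N D h t), 2)
  else if h % 4 = 1 then (decide (RelA b q relT N D h t), 2 + (Nat.unpair (h / 4)).1)
  else if h / 4 = 0 then
    (!(P.getI 0).1 || (P.getI (P.getI 0).2).1, 1 + (P.getI 0).2 + (P.getI (P.getI 0).2).2)
  else (false, 1)

/-- The evaluation of all suffixes of a list of symbols. -/
noncomputable def evL (b q : ℕ) (eqT : ℕ → Prop) (relT : ℕ → ℕ → Prop) (N D : ℕ) (l : List ℕ) :
    List (Bool × ℕ) :=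
  List.recOn l [] (fun h t P => evStep b q eqT relT N D h t P :: P)

/-- The evaluator. -/
def evF (b q : ℕ) (eqT : ℕ → Prop) (relT : ℕ → ℕ → Prop) (N D n : ℕ) : Prop :=
  ((evL b q eqT relT N D (Denumerable.ofNat (List ℕ) (Nat.unpair n).2)).getI 0).1 = true

variable {b q : ℕ} {eqT : ℕ → Prop} {relT : ℕ → ℕ → Prop}

theorem evL_cons (N D h : ℕ) (t : List ℕ) : evL b q eqT relT N D (h :: t) =
    evStep b q eqT relT N D h t (evL b q eqT relT N D t) :: evL b q eqT relT N D t := rfl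

theorem evL_getI (N D : ℕ) (l l' : List ℕ) :
    (evL b q eqT relT N D (l ++ l')).getI l.length = (evL b q eqT relT N D l').getI 0 := by
  induction l with
  | nil => rfl
  | cons h t ih =>
    rw [List.cons_append, evL_cons, List.length_cons, List.getI_cons_succ, ih]

theorem encode_list_map {α : Type*} [Encodable α] (l : List α) :
    Encodable.encode l = Encodable.encode (l.map Encodable.encode) := by
  induction l with
  | nil => rfl
  | cons a l ih => simp [ih]

variable {L L' : Language} {M : Type} [L.Structure M] [L'.Structure M]
  {tp : (Fin b → M) → ℕ} [∀ i, Encodable (L'.Functions i)] [∀ i, Encodable (L'.Relations i)]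

/-- The equality table. -/
def eqTOf {b : ℕ} (tp : (Fin b → M) → ℕ) (hb : 3 ≤ b) (τ : ℕ) : Prop :=
  ∃ y : Fin b → M, tp y = τ ∧ y ⟨0, by omega⟩ = y ⟨1, by omega⟩

/-- The relation table. -/
def relTOf (L' : Language) [L'.Structure M] [∀ i, Encodable (L'.Relations i)]
    {b : ℕ} (tp : (Fin b → M) → ℕ) (n τ : ℕ) : Prop :=
  ∃ (a : ℕ) (R : L'.Relations a) (ha : a ≤ b) (y : Fin b → M),
    n = Nat.pair a (Encodable.encode R) ∧ tp y = τ ∧ Structure.RelMap R (y ∘ Fin.castLE ha)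

/-- Codes of the symbols of a formula. -/
def syms {α : Type} [Encodable α] {n : ℕ} (φ : L'.BoundedFormula α n) : List ℕ :=
  φ.listEncode.map Encodable.encode

theorem tv_var {m : ℕ} (i : Fin m) :
    tv (Encodable.encode (Sum.inl ⟨0, Term.var (Sum.inl i)⟩ :
      (Σ k, L'.Term (Fin m ⊕ Fin k)) ⊕ ((Σ n, L'.Relations n) ⊕ ℕ))) = i := by
  have h1 : Encodable.encode (Term.var (Sum.inl i) : L'.Term (Fin m ⊕ Fin 0)) =
      Nat.succ (Nat.pair (2 * (2 * i)) 0) := rfl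
  rw [Encodable.encode_inl, Encodable.encode_sigma_val, h1]
  simp only [tv]
  rw [Nat.mul_div_cancel_left _ (by norm_num), Nat.unpair_pair]
  simp only [Nat.succ_sub_one, Nat.unpair_pair]
  omega

theorem ev_correct [L'.IsRelational] (hb : 3 ≤ b) (har' : ∀ a (_ : L'.Relations a), a ≤ b)
    (hinv : Inv L L' M) (htp : ∀ x y, tp x = tp y ↔ SO L x y) {N D m : ℕ} (hN : 0 < N)
    (x : Fin N → M) (hx : IsDg q tp D x) (hm : m ≤ N) (φ : L'.Formula (Fin m))
    (hφ : BoundedFormula.IsQF φ) (rest : List ℕ) :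
    ∃ v : Bool, (v = true ↔ φ.Realize (x ∘ Fin.castLE hm)) ∧
      (evL b q (eqTOf tp hb) (relTOf L' tp) N D (syms φ ++ rest)).getI 0 = (v, (syms φ).length) := by
  classical
  have : NeZero N := ⟨hN.ne'⟩
  have hvar : ∀ t : L'.Term (Fin m ⊕ Fin 0), ∃ i, t = Term.var (Sum.inl i) := by
    intro t
    cases t with
    | var s =>
      rcases s with i | i
      · exact ⟨i, rfl⟩
      · exact i.elim0
    | func f _ => exact isEmptyElim f
  induction hφ generalizing rest with
  | falsum =>
    refine ⟨false, by simp [Formula.Realize, BoundedFormula.Realize], ?_⟩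
    have : syms (BoundedFormula.falsum : L'.BoundedFormula (Fin m) 0) = [11] := rfl
    rw [this]
    rfl
  | of_isAtomic h =>
    cases h with
    | equal t₁ t₂ =>
      obtain ⟨i, rfl⟩ := hvar t₁
      obtain ⟨j, rfl⟩ := hvar t₂
      refine Exists.intro ?v (And.intro ?h1 ?h2)
      rotate_left 2
      · simp only [syms, Term.bdEqual, BoundedFormula.listEncode, List.map_cons, List.map_nil,
          List.cons_append, List.nil_append, evL_cons, List.getI_cons_zero, evStep]
        rw [if_pos (by rw [Encodable.encode_inl]; omega)]
        rfl
      · simp only [decide_eq_true_eq, EqA, List.getI_cons_zero, tv_var]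
        simp only [Formula.Realize, BoundedFormula.realize_bdEqual, Term.realize_var, Sum.elim_inl]
        constructor
        · rintro ⟨s, hs, h0, h1, y, hy, hy01⟩
          obtain ⟨s, rfl⟩ := exists_cd hs
          rw [hx s, htp] at hy
          have h2 := (hy.eq_iff _ _).1 hy01
          have e0 := dig_cd s ⟨0, by omega⟩
          have e1 := dig_cd s ⟨1, by omega⟩
          simp only at e0 e1
          rw [h0] at e0
          rw [h1] at e1
          have e0' : Fin.castLE hm i = s ⟨0, by omega⟩ := Fin.ext e0
          have e1' : Fin.castLE hm j = s ⟨1, by omega⟩ := Fin.ext e1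
          simp only [Function.comp, e0', e1']
          exact h2
        · intro hxy
          let s : Fin b → Fin N := fun t => if t.1 = 0 then Fin.castLE hm i else Fin.castLE hm j
          refine ⟨cd s, cd_lt s, ?_, ?_, x ∘ s, (hx s).symm, ?_⟩
          · have := dig_cd s ⟨0, by omega⟩
            simpa [s] using this
          · have := dig_cd s ⟨1, by omega⟩
            simpa [s] using this
          · simpa [s] using hxy
    | @rel a R ts =>
      have hts : ∀ t, ∃ i, ts t = Term.var (Sum.inl i) := fun t => hvar _
      choose u hu using hts
      have hRe : ∀ R : L'.Relations a, Encodable.encode (Sum.inr (Sum.inl ⟨a, R⟩) :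
          (Σ k, L'.Term (Fin m ⊕ Fin k)) ⊕ ((Σ n, L'.Relations n) ⊕ ℕ)) =
            2 * (2 * Nat.pair a (Encodable.encode R)) + 1 := fun R => rfl
      have hdiv : ∀ n, (2 * (2 * n) + 1) / 4 = n := fun n => by omega
      refine Exists.intro (decide (RelA b q (relTOf L' tp) N D
          (2 * (2 * Nat.pair a (Encodable.encode R)) + 1)
            (Encodable.encode (Sum.inr (Sum.inr 0) :
            (Σ k, L'.Term (Fin m ⊕ Fin k)) ⊕ ((Σ n, L'.Relations n) ⊕ ℕ)) ::
              (List.map (Encodable.encode ∘ fun i => (Sum.inl ⟨0, ts i⟩ :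
            (Σ k, L'.Term (Fin m ⊕ Fin k)) ⊕ ((Σ n, L'.Relations n) ⊕ ℕ))) (List.finRange a) ++ rest))))
          (And.intro ?h3 ?h4)
      rotate_left 1
      · simp only [syms, Relations.boundedFormula, BoundedFormula.listEncode, List.map_cons,
          List.map_nil, List.map_append, List.map_map,
          List.cons_append, List.nil_append, evL_cons, List.getI_cons_zero, evStep]
        rw [hRe, if_neg (by omega), if_pos (by omega), hdiv, Nat.unpair_pair]
        simp only [List.length_cons, List.length_map, List.length_finRange]
        refine Prod.ext (by congr) ?_
        show 2 + a = a + 1 + 1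
        omega
      · have hlist : ∀ i (hi : i < a), tv ((Encodable.encode (Sum.inr (Sum.inr 0) :
            (Σ k, L'.Term (Fin m ⊕ Fin k)) ⊕ ((Σ n, L'.Relations n) ⊕ ℕ)) ::
            ((List.finRange a).map (Encodable.encode ∘ fun i => (Sum.inl ⟨0, ts i⟩ :
              (Σ k, L'.Term (Fin m ⊕ Fin k)) ⊕ ((Σ n, L'.Relations n) ⊕ ℕ))) ++ rest)).getI
              (1 + i)) = u ⟨i, hi⟩ := by
          intro i hi
          rw [add_comm, List.getI_cons_succ, List.getI_append _ _ _ (by simpa using hi),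
            List.getI_eq_getElem _ (by simpa using hi)]
          simp only [List.getElem_map, List.getElem_finRange, Function.comp]
          rw [hu]
          exact tv_var _
        simp only [decide_eq_true_eq, RelA, hdiv, Nat.unpair_pair]
        simp only [Formula.Realize, Relations.boundedFormula, BoundedFormula.Realize]
        have hre : (fun i => (ts i).realize (Sum.elim (x ∘ Fin.castLE hm) (default : Fin 0 → M))) =
            fun i => x (Fin.castLE hm (u i)) := by
          funext i
          rw [hu]
          rfl
        rw [hre]
        constructor
        · rintro ⟨s, hs, h0, a', R', ha', y, hpair, hy, hR⟩
          obtain ⟨rfl, h2⟩ := Nat.pair_eq_pair.1 hpair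
          obtain rfl := Encodable.encode_injective h2
          obtain ⟨s, rfl⟩ := exists_cd hs
          rw [hx s, htp] at hy
          let ψ : L'.Formula (Fin a) := Relations.formula R (fun i => Term.var i)
          have hψ : ∀ z : Fin a → M, ψ.Realize z ↔ Structure.RelMap R z := fun z => by
            simp [ψ, Formula.realize_rel]
          have h3 := hinv ⟨a, ψ⟩ _ _ (hy.comp (Fin.castLE ha')) ((hψ _).2 hR)
          have h4 := (hψ _).1 h3
          convert h4 using 1
          funext i
          simp only [Function.comp]
          congr 1
          apply Fin.ext
          have e := dig_cd s (Fin.castLE ha' i)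
          have e2 := h0 i i.2
          rw [hlist i i.2] at e2
          simp only [Fin.val_castLE] at e e2 ⊢
          rw [← e, e2]
        · intro hR
          have ha := har' a R
          let s : Fin b → Fin N := fun t => if h : t.1 < a then Fin.castLE hm (u ⟨t.1, h⟩)
            else ⟨0, hN⟩
          refine ⟨cd s, cd_lt s, fun i hi => ?_, a, R, ha, x ∘ s, rfl, (hx s).symm, ?_⟩
          · have e := dig_cd s ⟨i, by omega⟩
            simp only at e
            rw [e, hlist i hi]
            simp [s, hi]
          · convert hR using 1
            funext i
            simp [s]
  | @imp φ ψ h1 h2 ih1 ih2 =>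
    have hs : syms (φ.imp ψ) = 3 :: (syms φ ++ syms ψ) := by
      simp only [syms, BoundedFormula.listEncode, List.map_append, List.map_cons, List.cons_append]
      rfl
    obtain ⟨v1, hv1, e1⟩ := ih1 (syms ψ ++ rest)
    obtain ⟨v2, hv2, e2⟩ := ih2 rest
    refine ⟨!v1 || v2, ?_, ?_⟩
    · have : Formula.Realize (φ.imp ψ) (x ∘ Fin.castLE hm) ↔
        (Formula.Realize φ (x ∘ Fin.castLE hm) → Formula.Realize ψ (x ∘ Fin.castLE hm)) := Iff.rfl
      rw [this, ← hv1, ← hv2]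
      cases v1 <;> cases v2 <;> simp
    · rw [hs, List.cons_append, List.append_assoc, evL_cons, List.getI_cons_zero, evStep,
        if_neg (by norm_num), if_neg (by norm_num), if_pos (by norm_num), e1]
      simp only [evL_getI, e2, List.length_cons, List.length_append]
      congr 1
      omega

theorem encode_formulaCode (φ : FormulaCode L') :
    Encodable.encode φ = Nat.pair φ.1 (Encodable.encode (syms φ.2)) := by
  have h : Encodable.encode φ.2 = Encodable.encode φ.2.listEncode := rfl
  rw [syms, ← encode_list_map, ← h]
  rfl

theorem evF_correct [L'.IsRelational] (hb : 3 ≤ b) (har' : ∀ a (_ : L'.Relations a), a ≤ b)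
    (hinv : Inv L L' M) (htp : ∀ x y, tp x = tp y ↔ SO L x y) {N D : ℕ} (hN : 0 < N)
    (x : Fin N → M) (hx : IsDg q tp D x) (φ : FormulaCode L') (hm : φ.1 ≤ N)
    (hφ : BoundedFormula.IsQF φ.2) :
    evF b q (eqTOf tp hb) (relTOf L' tp) N D (Encodable.encode φ) ↔ Sat x φ := by
  rw [evF, encode_formulaCode, Nat.unpair_pair, Denumerable.ofNat_encode]
  obtain ⟨v, hv, e⟩ := ev_correct hb har' hinv htp hN x hx hm φ.2 hφ []
  rw [List.append_nil] at e
  rw [e]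
  exact hv.trans ⟨fun h _ => h, fun h => h hm⟩

end Eval
end PaperDef

namespace PaperDef

section Prim

attribute [fun_prop] Primrec

variable {α β γ : Type*} [Primcodable α] [Primcodable β] [Primcodable γ]

@[fun_prop] theorem pr_id : Primrec fun a : α => a := Primrec.id
@[fun_prop] theorem pr_const (b : β) : Primrec fun _ : α => b := Primrec.const b
@[fun_prop] theorem pr_comp {f : β → γ} {g : α → β} (hf : Primrec f) (hg : Primrec g) :
    Primrec fun a => f (g a) := hf.comp hg
@[fun_prop] theorem pr_fst {f : α → β × γ} (hf : Primrec f) : Primrec fun a => (f a).1 :=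
  Primrec.fst.comp hf
@[fun_prop] theorem pr_snd {f : α → β × γ} (hf : Primrec f) : Primrec fun a => (f a).2 :=
  Primrec.snd.comp hf
@[fun_prop] theorem pr_mk {f : α → β} {g : α → γ} (hf : Primrec f) (hg : Primrec g) :
    Primrec fun a => (f a, g a) := hf.pair hg
@[fun_prop] theorem pr_add {f g : α → ℕ} (hf : Primrec f) (hg : Primrec g) :
    Primrec fun a => f a + g a := Primrec.nat_add.comp hf hg
@[fun_prop] theorem pr_sub {f g : α → ℕ} (hf : Primrec f) (hg : Primrec g) :
    Primrec fun a => f a - g a := Primrec.nat_sub.comp hf hg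
@[fun_prop] theorem pr_div {f g : α → ℕ} (hf : Primrec f) (hg : Primrec g) :
    Primrec fun a => f a / g a := Primrec.nat_div.comp hf hg
@[fun_prop] theorem pr_mod {f g : α → ℕ} (hf : Primrec f) (hg : Primrec g) :
    Primrec fun a => f a % g a := Primrec.nat_mod.comp hf hg
@[fun_prop] theorem pr_pow {f g : α → ℕ} (hf : Primrec f) (hg : Primrec g) :
    Primrec fun a => f a ^ g a :=
  (Primrec₂.unpaired'.1 Nat.Primrec.pow : Primrec₂ ((· ^ ·) : ℕ → ℕ → ℕ)).comp hf hg
@[fun_prop] theorem pr_unpair {f : α → ℕ} (hf : Primrec f) :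
    Primrec fun a => Nat.unpair (f a) := Primrec.unpair.comp hf
@[fun_prop] theorem pr_getI [Inhabited β] {f : α → List β} {g : α → ℕ} (hf : Primrec f)
    (hg : Primrec g) : Primrec fun a => (f a).getI (g a) := Primrec.list_getI.comp hf hg
@[fun_prop] theorem pr_cons {f : α → β} {g : α → List β} (hf : Primrec f)
    (hg : Primrec g) : Primrec fun a => f a :: g a := Primrec.list_cons.comp hf hg
@[fun_prop] theorem pr_dig {f g h : α → ℕ} (hf : Primrec f) (hg : Primrec g) (hh : Primrec h) :
    Primrec fun a => dig (f a) (g a) (h a) := by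
  unfold dig
  fun_prop
@[fun_prop] theorem pr_tv {f : α → ℕ} (hf : Primrec f) :
    Primrec fun a => tv (f a) := by
  unfold tv
  fun_prop
@[fun_prop] theorem pr_or {f g : α → Bool} (hf : Primrec f) (hg : Primrec g) :
    Primrec fun a => (f a || g a) := Primrec.or.comp hf hg
@[fun_prop] theorem pr_not {f : α → Bool} (hf : Primrec f) :
    Primrec fun a => (!f a) := Primrec.not.comp hf

theorem pp_eq {f g : α → ℕ} (hf : Primrec f) (hg : Primrec g) :
    PrimrecPred fun a => f a = g a := Primrec.eq.comp hf hg

theorem pp_imp {P Q : α → Prop} (hP : PrimrecPred P) (hQ : PrimrecPred Q) :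
    PrimrecPred fun a => P a → Q a := (hP.not.or hQ).of_eq fun a => by tauto

theorem pp_all {f : α → ℕ} {R : α → ℕ → Prop} (hf : Primrec f)
    (hR : PrimrecPred fun x : α × ℕ => R x.1 x.2) : PrimrecPred fun a => ∀ x < f a, R a x := by
  have h : PrimrecRel fun (x : ℕ) (a : α) => R a x :=
    PrimrecPred.comp hR (Primrec.snd.pair Primrec.fst)
  exact (h.forall_mem_list.comp (Primrec.list_range.comp hf) Primrec.id).of_eq (by simp)

theorem pp_ex {f : α → ℕ} {R : α → ℕ → Prop} (hf : Primrec f)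
    (hR : PrimrecPred fun x : α × ℕ => R x.1 x.2) : PrimrecPred fun a => ∃ x < f a, R a x := by
  have h : PrimrecRel fun (x : ℕ) (a : α) => R a x :=
    PrimrecPred.comp hR (Primrec.snd.pair Primrec.fst)
  exact (h.exists_mem_list.comp (Primrec.list_range.comp hf) Primrec.id).of_eq (by simp)

theorem pp_mem {f : α → List ℕ} {R : α → ℕ → Prop} (hf : Primrec f)
    (hR : PrimrecPred fun x : α × ℕ => R x.1 x.2) : PrimrecPred fun a => ∀ x ∈ f a, R a x := by
  have h : PrimrecRel fun (x : ℕ) (a : α) => R a x :=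
    PrimrecPred.comp hR (Primrec.snd.pair Primrec.fst)
  exact h.forall_mem_list.comp hf Primrec.id

theorem pp_re (b q : ℕ) {N N' D ρ D' : α → ℕ} (hN : Primrec N) (hN' : Primrec N') (hD : Primrec D)
    (hρ : Primrec ρ) (hD' : Primrec D') :
    PrimrecPred fun a => Re b q (N a) (N' a) (D a) (ρ a) (D' a) := by
  unfold Re
  refine pp_all (by fun_prop) (pp_all (by fun_prop) (pp_imp (pp_all (by fun_prop)
    (pp_eq (by fun_prop) (by fun_prop))) (pp_eq (by fun_prop) (by fun_prop))))


theorem pp_finite {S : Set α} (hS : S.Finite) : PrimrecPred fun a => a ∈ S := by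
  classical
  induction S, hS using Set.Finite.induction_on with
  | empty => exact ((Primrec.const false).primrecPred (p := fun _ : α => False)).of_eq (by simp)
  | @insert c _ _ _ ih => exact ((Primrec.eq.comp Primrec.id (Primrec.const c)).or ih).of_eq (by simp)

section

variable {b q : ℕ} {Tab : ℕ → ℕ → ℕ → Prop}

theorem pp_tab (hTab : PrimrecPred fun x : ℕ × ℕ × ℕ => Tab x.1 x.2.1 x.2.2)
    {f g h : α → ℕ} (hf : Primrec f) (hg : Primrec g) (hh : Primrec h) :
    PrimrecPred fun a => Tab (f a) (g a) (h a) :=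
  PrimrecPred.comp hTab (f := fun a => (f a, g a, h a)) (by fun_prop)

theorem pp_valid (hTab : PrimrecPred fun x : ℕ × ℕ × ℕ => Tab x.1 x.2.1 x.2.2)
    {N D : α → ℕ} (hN : Primrec N) (hD : Primrec D) :
    PrimrecPred fun a => Valid b q Tab (N a) (D a) := by
  unfold Valid
  refine pp_all (by fun_prop) (pp_all (by fun_prop) (pp_all (by fun_prop) (pp_imp
    (pp_all (by fun_prop) (pp_eq (by fun_prop) (by fun_prop)))
    (pp_tab hTab (by fun_prop) (by fun_prop) (by fun_prop)))))

theorem pp_good (hTab : PrimrecPred fun x : ℕ × ℕ × ℕ => Tab x.1 x.2.1 x.2.2)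
    {p k r w : α → ℕ} (hp : Primrec p) (hk : Primrec k) (hr : Primrec r)
    (hw : Primrec w) :
    PrimrecPred fun a => Good b q Tab (p a) (k a) (r a) (w a) := by
  unfold Good
  refine pp_all (by fun_prop) (PrimrecPred.and (pp_valid hTab (by fun_prop) (by fun_prop))
    (pp_all (by fun_prop) (pp_imp (pp_all (by fun_prop) (pp_eq (by fun_prop) (by fun_prop)))
      (pp_re b q (by fun_prop) (by fun_prop) (by fun_prop) (by fun_prop) (by fun_prop)))))

theorem pp_phi (hTab : PrimrecPred fun x : ℕ × ℕ × ℕ => Tab x.1 x.2.1 x.2.2)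
    {ev : ℕ → ℕ → ℕ → Prop} {p n₀ : α → ℕ} {ls : α → List ℕ}
    (hev : PrimrecPred fun x : ℕ × ℕ × ℕ => ev x.1 x.2.1 x.2.2)
    (hp : Primrec p) (hn : Primrec n₀) (hl : Primrec ls) :
    PrimrecPred fun a => Phi b q Tab ev (p a) (n₀ a) (ls a) := by
  unfold Phi
  refine pp_ex (by fun_prop) (pp_ex (by fun_prop) (pp_ex (by fun_prop) (PrimrecPred.and
    (pp_all (by fun_prop) (PrimrecPred.and (pp_valid hTab (by fun_prop) (by fun_prop))
      (pp_tab hev (by fun_prop) (by fun_prop) (by fun_prop))))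
    (pp_all (by fun_prop) (pp_imp (pp_good hTab (by fun_prop) (by fun_prop) (by fun_prop)
      (by fun_prop)) (PrimrecPred.and (pp_valid hTab (by fun_prop) (by fun_prop))
      (PrimrecPred.and ?_ (PrimrecPred.and ?_ ?_))))))))
  · refine pp_all (by fun_prop) (pp_imp (pp_good hTab (by fun_prop) (by fun_prop) (by fun_prop)
      (by fun_prop)) (pp_all (by fun_prop) (pp_all (by fun_prop) (pp_imp (pp_all (by fun_prop)
        (PrimrecPred.and (pp_eq (by fun_prop) (by fun_prop)) (pp_eq (by fun_prop) (by fun_prop))))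
      (pp_imp (pp_all (by fun_prop) 
        (pp_re b q (by fun_prop) (by fun_prop) (by fun_prop) (by fun_prop) (by fun_prop)))
        (pp_re b q (by fun_prop) (by fun_prop) (by fun_prop) (by fun_prop) (by fun_prop)))))))
  · refine pp_mem (by fun_prop) (pp_imp (pp_all (by fun_prop)
      (pp_tab hev (by fun_prop) (by fun_prop) (by fun_prop)))
      (pp_tab hev (by fun_prop) (by fun_prop) (by fun_prop)))
  · refine pp_imp (pp_all (by fun_prop) (pp_all (by fun_prop) (pp_imp (pp_all (by fun_prop)
        (PrimrecPred.and (pp_eq (by fun_prop) (by fun_prop)) (pp_eq (by fun_prop) (by fun_prop))))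
        (pp_re b q (by fun_prop) (by fun_prop) (by fun_prop) (by fun_prop) (by fun_prop)))))
      (PrimrecPred.not (pp_tab hev (by fun_prop) (by fun_prop) (by fun_prop)))

end

theorem pp_eqA (b q : ℕ) {eqT : ℕ → Prop} (he : PrimrecPred eqT) {N D h : α → ℕ} {t : α → List ℕ}
    (hN : Primrec N) (hD : Primrec D) (hh : Primrec h) (ht : Primrec t) :
    PrimrecPred fun a => EqA b q eqT (N a) (D a) (h a) (t a) := by
  unfold EqA
  exact pp_ex (by fun_prop) (PrimrecPred.and (pp_eq (by fun_prop) (by fun_prop))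
    (PrimrecPred.and (pp_eq (by fun_prop) (by fun_prop)) (he.comp (by fun_prop))))

theorem pp_relA (b q : ℕ) {relT : ℕ → ℕ → Prop} (he : PrimrecPred fun x : ℕ × ℕ => relT x.1 x.2)
    {N D h : α → ℕ} {t : α → List ℕ}
    (hN : Primrec N) (hD : Primrec D) (hh : Primrec h) (ht : Primrec t) :
    PrimrecPred fun a => RelA b q relT (N a) (D a) (h a) (t a) := by
  unfold RelA
  refine pp_ex (by fun_prop) (PrimrecPred.and (pp_all (by fun_prop)
    (pp_eq (by fun_prop) (by fun_prop))) ?_)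
  exact PrimrecPred.comp he (f := fun x : α × ℕ => (h x.1 / 4, dig q (D x.1) x.2)) (by fun_prop)

theorem pr_evStep (b q : ℕ) {eqT : ℕ → Prop} {relT : ℕ → ℕ → Prop} (he : PrimrecPred eqT)
    (hr : PrimrecPred fun x : ℕ × ℕ => relT x.1 x.2)
    {N D h : α → ℕ} {t : α → List ℕ} {P : α → List (Bool × ℕ)}
    (hN : Primrec N) (hD : Primrec D) (hh : Primrec h) (ht : Primrec t) (hP : Primrec P) :
    Primrec fun a => evStep b q eqT relT (N a) (D a) (h a) (t a) (P a) := by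
  classical
  have h1 : Primrec fun a => decide (EqA b q eqT (N a) (D a) (h a) (t a)) :=
    (pp_eqA b q he hN hD hh ht).decide
  have h2 : Primrec fun a => decide (RelA b q relT (N a) (D a) (h a) (t a)) :=
    (pp_relA b q hr hN hD hh ht).decide
  have h3 : Primrec fun a => evStep b q eqT relT (N a) (D a) (h a) (t a) (P a) := by
    unfold evStep
    refine Primrec.ite (pp_eq (by fun_prop) (by fun_prop)) ?_ (Primrec.ite
      (pp_eq (by fun_prop) (by fun_prop)) ?_ (Primrec.ite
      (pp_eq (by fun_prop) (by fun_prop)) ?_ ?_))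
    · refine pr_mk ?_ (by fun_prop)
      convert h1
    · refine pr_mk ?_ (by fun_prop)
      convert h2
    · fun_prop
    · fun_prop
  exact h3

theorem pp_evF (b q : ℕ) {eqT : ℕ → Prop} {relT : ℕ → ℕ → Prop} (he : PrimrecPred eqT)
    (hr : PrimrecPred fun x : ℕ × ℕ => relT x.1 x.2) :
    PrimrecPred fun x : ℕ × ℕ × ℕ => evF b q eqT relT x.1 x.2.1 x.2.2 := by
  have h1 : Primrec fun x : ℕ × ℕ × ℕ => evL b q eqT relT x.1 x.2.1
      (Denumerable.ofNat (List ℕ) (Nat.unpair x.2.2).2) := by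
    unfold evL
    refine Primrec.list_rec (f := fun x : ℕ × ℕ × ℕ =>
        Denumerable.ofNat (List ℕ) (Nat.unpair x.2.2).2) (g := fun _ => [])
      (h := fun x y => evStep b q eqT relT x.1 x.2.1 y.1 y.2.1 y.2.2 :: y.2.2)
      ((Primrec.ofNat _).comp (by fun_prop)) (Primrec.const _) ?_
    refine pr_cons (pr_evStep b q he hr (by fun_prop) (by fun_prop) (by fun_prop) (by fun_prop)
      (by fun_prop)) (by fun_prop)
  unfold evF
  exact Primrec.eq.comp (by fun_prop) (Primrec.const _)

theorem Valid.congr {b q : ℕ} {Tab : ℕ → ℕ → ℕ → Prop} {N D : ℕ} :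
    Valid b q (fun τ π τ' => π < b ^ b ∧ Tab τ π τ') N D ↔ Valid b q Tab N D :=
  ⟨fun h s hs t ht π hπ hi => (h s hs t ht π hπ hi).2,
    fun h s hs t ht π hπ hi => ⟨hπ, h s hs t ht π hπ hi⟩⟩

theorem Phi.congr {b q : ℕ} {Tab ev : ℕ → ℕ → ℕ → Prop} {p n₀ : ℕ} {ls : List ℕ} :
    Phi b q (fun τ π τ' => π < b ^ b ∧ Tab τ π τ') ev p n₀ ls ↔ Phi b q Tab ev p n₀ ls := by
  simp only [Phi, Good, Valid.congr]

end Prim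
end PaperDef

namespace PaperDef

section Final

variable {L L' : Language} {M : Type} [L.Structure M] [L'.Structure M]

theorem exists_tp [L.IsRelational] (hLfin : Finite (Σ i, L.Relations i))
    (hhom : L.IsUltrahomogeneous M) (b : ℕ) :
    ∃ (q : ℕ) (tp : (Fin b → M) → ℕ), (∀ x, tp x < q) ∧ ∀ x y, tp x = tp y ↔ SO L x y := by
  classical
  let P := (Fin b → Fin b → Prop) × (∀ R : Σ a, L.Relations a, (Fin R.1 → Fin b) → Prop)
  let pat : (Fin b → M) → P := fun x =>
    (fun i j => x i = x j, fun R κ => Structure.RelMap R.2 (x ∘ κ))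
  have hP : Finite P := inferInstance
  refine ⟨Nat.card P, fun x => Finite.equivFin P (pat x), fun x => (Finite.equivFin P (pat x)).2,
    fun x y => ?_⟩
  rw [← Fin.ext_iff, (Finite.equivFin P).injective.eq_iff]
  constructor
  · intro h
    have h1 := congrArg Prod.fst h
    have h2 := congrArg Prod.snd h
    refine SO.of_pattern hhom x y (fun i j => ?_) (fun a r κ => ?_)
    · exact iff_of_eq (congrFun (congrFun h1 i) j)
    · exact iff_of_eq (congrFun (congrFun h2 ⟨a, r⟩) κ)
  · intro h
    refine Prod.ext ?_ ?_
    · funext i j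
      exact propext (h.eq_iff i j)
    · funext R κ
      exact propext ((h.comp κ).rel_iff R.2)

theorem inv_of_reduct [L'.IsRelational] (hred : IsReduct L L' M) : Inv L L' M := by
  rintro φ x y ⟨g, hg⟩ hx
  let g' : M ≃[L'] M :=
    { g.toEquiv with
      map_fun' := fun f _ => isEmptyElim f
      map_rel' := fun {n} r z => by
        obtain ⟨ψ, hψ⟩ := hred n r
        rw [hψ, hψ]
        exact StrongHomClass.realize_formula g ψ }
  have hy : y = g' ∘ x := funext fun i => (hg i).symm
  rw [hy]
  exact (StrongHomClass.realize_formula g' φ.2).2 hx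

theorem exists_bound {ι : Type*} [Finite ι] (f : ι → ℕ) : ∃ B, ∀ i, f i ≤ B := by
  obtain ⟨B, hB⟩ := (Set.finite_range f).bddAbove
  exact ⟨B, fun i => hB ⟨i, rfl⟩⟩

theorem encode_mem_le {α : Type*} [Encodable α] {a : α} {l : List α} (h : a ∈ l) :
    Encodable.encode a ≤ Encodable.encode l := by
  induction l with
  | nil => simp at h
  | cons c l ih =>
    rw [Encodable.encode_list_cons]
    rcases List.mem_cons.1 h with rfl | h
    · exact (Nat.left_le_pair _ _).trans (Nat.le_succ _)
    · exact (ih h).trans ((Nat.right_le_pair _ _).trans (Nat.le_succ _))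

end Final

/-- **Theorem 1 of the paper.**  Let `Δ` (an `L`-structure on `M`) be a countably infinite
structure with finite relational signature that is ordered, homogeneous, Ramsey and finitely
bounded, and let `Γ` (an `L'`-structure on `M`) be a reduct of `Δ` with finite relational
signature.  Then the problem `Expr_pp(Γ)` is decidable. -/
theorem decidability_of_Expr_pp
    (L L' : Language) (M : Type) [L.Structure M] [L'.Structure M]
    [Countable M] [Infinite M]
    [∀ i, IsEmpty (L'.Functions i)] [∀ i, Encodable (L'.Relations i)]
    (hLrel : ∀ i, IsEmpty (L.Functions i)) (hLfin : Finite (Σ i, L.Relations i))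
    (hL'fin : Finite (Σ i, L'.Relations i))
    (hord : Ordered L M) (hhom : L.IsUltrahomogeneous M)
    (hram : RamseyClass (L.age M)) (hfb : FinitelyBounded L M)
    (hred : IsReduct L L' M) :
    DecidableExprPP L' M := by
  classical
  have hLr : L.IsRelational := hLrel
  have hLr' : L'.IsRelational := inferInstance
  obtain ⟨k, F, hF, hage⟩ := hfb
  obtain ⟨B1, hB1⟩ := exists_bound (fun R : Σ i, L.Relations i => 2 * R.1)
  obtain ⟨B2, hB2⟩ := exists_bound (fun R : Σ i, L'.Relations i => R.1)
  obtain ⟨B3, hB3⟩ := exists_bound (fun i : Fin k => Nat.card (F i))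
  obtain ⟨b, hbdef⟩ : ∃ b, b = B1 + B2 + B3 + 3 := ⟨_, rfl⟩
  have hb : 3 ≤ b := by omega
  have har : ∀ a (_ : L.Relations a), 2 * a ≤ b := fun a R => by
    have := hB1 ⟨a, R⟩
    simp only at this
    omega
  have har' : ∀ a (_ : L'.Relations a), a ≤ b := fun a R => by
    have := hB2 ⟨a, R⟩
    simp only at this
    omega
  have hFb : ∀ i, Nat.card (F i) ≤ b := fun i => by
    have := hB3 i
    omega
  have hreal : RealB L M b := fun V _ y hy => realize_of_local hhom F hF hage hb hFb har y hy
  have : NeZero b := ⟨by omega⟩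
  obtain ⟨q, tp, htq, htp⟩ := exists_tp hLfin hhom b
  have hinv : Inv L L' M := inv_of_reduct hred
  let ev := evF b q (eqTOf tp hb) (relTOf L' tp)
  let Tab : ℕ → ℕ → ℕ → Prop := fun τ π τ' => π < b ^ b ∧ TabOf tp τ π τ'
  have hTab : PrimrecPred fun x : ℕ × ℕ × ℕ => Tab x.1 x.2.1 x.2.2 := by
    refine pp_finite (S := {x : ℕ × ℕ × ℕ | Tab x.1 x.2.1 x.2.2}) (Set.Finite.subset
      ((Set.finite_Iio q).prod ((Set.finite_Iio (b ^ b)).prod (Set.finite_Iio q))) ?_)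
    rintro ⟨τ, π, τ'⟩ ⟨hπ, y, h1, h2⟩
    exact ⟨(show tp y = τ from h1) ▸ htq _, hπ, (show tp _ = τ' from h2) ▸ htq _⟩
  have heqT : PrimrecPred (eqTOf tp hb) := by
    refine pp_finite (S := {x : ℕ | eqTOf tp hb x}) (Set.Finite.subset (Set.finite_Iio q) ?_)
    rintro τ ⟨y, rfl, -⟩
    exact htq _
  have hrelT : PrimrecPred fun x : ℕ × ℕ => relTOf L' tp x.1 x.2 := by
    refine pp_finite (S := {x : ℕ × ℕ | relTOf L' tp x.1 x.2}) (Set.Finite.subset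
      ((Set.finite_range (fun R : Σ i, L'.Relations i =>
        Nat.pair R.1 (Encodable.encode R.2))).prod (Set.finite_Iio q)) ?_)
    rintro ⟨n, τ⟩ ⟨a, R, ha, y, rfl, rfl, -⟩
    exact ⟨⟨⟨a, R⟩, rfl⟩, htq _⟩
  have hevp : PrimrecPred fun x : ℕ × ℕ × ℕ => ev x.1 x.2.1 x.2.2 := pp_evF b q heqT hrelT
  have hphi : PrimrecPred fun n : ℕ => Phi b q Tab ev (n + b) (Nat.unpair n).1
      (Denumerable.ofNat (List ℕ) (Nat.unpair n).2) :=
    pp_phi hTab hevp (by fun_prop) (by fun_prop) ((Primrec.ofNat _).comp (by fun_prop))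
  refine ⟨fun n => decide (¬ Phi b q Tab ev (n + b) (Nat.unpair n).1
      (Denumerable.ofNat (List ℕ) (Nat.unpair n).2)), hphi.not.decide.to_comp, ?_⟩
  intro φ₀ l hq₀ hql
  rw [decide_eq_true_eq, Encodable.encode_prod_val, Nat.unpair_pair, encode_list_map l]
  simp only [Denumerable.ofNat_encode]
  rw [← encode_list_map l]
  obtain ⟨p, hpdef⟩ : ∃ p, p = Nat.pair (Encodable.encode φ₀) (Encodable.encode l) + b := ⟨_, rfl⟩
  rw [← hpdef]
  have hcode : ∀ φ : FormulaCode L', φ.1 ≤ Encodable.encode φ := fun φ => by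
    rw [encode_formulaCode]
    exact Nat.left_le_pair _ _
  have hp₀ : φ₀.1 ≤ p := by
    have h1 := hcode φ₀
    have h2 := Nat.left_le_pair (Encodable.encode φ₀) (Encodable.encode l)
    omega
  have hpl : ∀ φ ∈ l, φ.1 ≤ p := fun φ hφ => by
    have h1 := hcode φ
    have h2 := Nat.right_le_pair (Encodable.encode φ₀) (Encodable.encode l)
    have h3 := encode_mem_le hφ
    omega
  have hbp : b ≤ p := by omega
  have hp : 0 < p := by omega
  have : NeZero p := ⟨by omega⟩
  have : NeZero (p + p) := ⟨by omega⟩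
  have hcodes : ∀ (N : ℕ) [NeZero N] (x y : Fin N → M),
      (⟨codeT tp htq x, codeT_lt tp htq x⟩ : Fin (q ^ N ^ b)) =
        ⟨codeT tp htq y, codeT_lt tp htq y⟩ ↔ SO L x y := by
    intro N _ x y
    rw [Fin.mk.injEq]
    constructor
    · intro h
      have h1 := isDg_codeT tp htq x
      rw [h] at h1
      exact IsDg.so hhom hb har htp h1 (isDg_codeT tp htq y)
    · intro h
      have : ∀ s : Fin b → Fin N, tp (x ∘ s) = tp (y ∘ s) := fun s => (htp _ _).2 (h.comp s)
      simp only [codeT, this]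
  have hcrit : Crit L M p (q ^ p ^ b) φ₀ l ↔
      Phi b q Tab ev p (Encodable.encode φ₀) (l.map Encodable.encode) := by
    rw [Phi.congr]
    refine crit_iff_phi hhom hb har hreal htq htp hp ev φ₀ l Encodable.encode ?_ hp₀ hpl hinv
    intro φ hφ N D x hN hx
    rcases List.mem_cons.1 hφ with rfl | hφ
    · exact evF_correct hb har' hinv htp (by omega) x hx _ (hp₀.trans hN) hq₀
    · exact evF_correct hb har' hinv htp (by omega) x hx _ ((hpl _ hφ).trans hN) (hql _ hφ)
  rw [← hcrit]
  constructor
  · intro h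
    by_contra hno
    exact h (crit_of_not_pp hord hhom hram hinv _ (hcodes p) _ (hcodes (p + p)) φ₀ l hp₀ hpl hno)
  · intro h hc
    exact not_pp_of_crit hhom hinv hb har hreal hbp φ₀ l hp₀ hpl hc h

end PaperDef
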